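/- Let k be a field of characteristic zero, J a homogeneous prime ideal of a polynomial ring k[x_1, …, x_p], R = k[x_1, …, x_p]/J, m the maximal homogeneous ideal of R, and d = dim R. Assume depth(R_m) ≥ 2. Then for every homogeneous ideal I ⊆ R, the limit lim_{n→∞} λ(H^0_m(R/I^n))/n^d exists. -/

import Mathlib

/-!
STATEMENT 1: Let `k` be a field of characteristic zero, `J` a homogeneous prime ideal of a
polynomial ring `k[x_1, …, x_p]`, `R = k[x_1, …, x_p]/J`, `m` the maximal homogeneous ideal
of `R`, and `d = dim R`.  Assume `depth(R_m) ≥ 2`.  Then for every homogeneous ideal `I ⊆ R`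
the limit `lim_{n→∞} λ(H⁰_m(R/Iⁿ))/n^d` exists.

We model `R` abstractly as a finitely generated ℕ-graded `k`-algebra domain whose grading is
standard (generated in degree 1) — this is exactly the data of a quotient of a polynomial ring
(with its standard grading) by a homogeneous prime ideal.  The maximal homogeneous ideal is the
irrelevant ideal `m = ⊕_{n>0} 𝒜 n`; the condition `depth(R_m) ≥ 2` is expressed by the
existence of a regular sequence of length two on `R` contained in `m` (i.e. `grade(m, R) ≥ 2`,
which equals the depth of the localization `R_m` since `m` is maximal).  `H⁰_m` is the
`m`-power-torsion functor and `λ` is length = `k`-vector space dimension.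
-/

open Filter

/-- The zeroth local cohomology module `H⁰_J(M) = {x ∈ M | ∃ n, Jⁿ • x = 0}`. -/
noncomputable def H0 {R M : Type*} [CommRing R] [AddCommGroup M] [Module R M]
    (J : Ideal R) : Submodule R M :=
  ⨆ n : ℕ, Submodule.torsionBySet R M (J ^ n : Ideal R)


theorem lim_of_superadd (a : ℕ → ℕ) (d : ℕ) (B : ℝ)
    (hB : ∀ n, 1 ≤ n → (a n : ℝ) ≤ B * (n : ℝ) ^ d)
    (hs : ∀ m q r, 1 ≤ m → 1 ≤ q → (d + 1) * q ≤ r → a m * q ^ d ≤ a (q * m + r)) :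
    ∃ L : ℝ, Tendsto (fun n : ℕ => (a n : ℝ) / (n : ℝ) ^ d) atTop (nhds L) := by
  classical
  set b : ℕ → ℝ := fun m => (a (m+1) : ℝ) / ((m + 1 + (d + 1) : ℕ) : ℝ) ^ d with hb
  have hBnn : 0 ≤ B := by
    have := hB 1 le_rfl
    simp at this
    exact le_trans (Nat.cast_nonneg _) this
  have hbdd : BddAbove (Set.range b) := by
    refine ⟨B, ?_⟩
    rintro _ ⟨m, rfl⟩
    have h1 := hB (m+1) (by omega)
    have hpos : (0:ℝ) < ((m + 1 + (d + 1) : ℕ) : ℝ) ^ d := by positivity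
    rw [hb]
    simp only
    rw [div_le_iff₀ hpos]
    refine h1.trans ?_
    gcongr
    all_goals omega
  set L := ⨆ m, b m with hL
  refine ⟨L, ?_⟩
  have hLb : ∀ m, b m ≤ L := fun m => le_ciSup hbdd m
  have hLnn : 0 ≤ L := le_trans (by rw [hb]; positivity) (hLb 0)
  rw [tendsto_order]
  constructor
  · intro x hx
    obtain ⟨m, hm⟩ := exists_lt_of_lt_ciSup hx
    set M : ℕ := m + 1 + (d + 1) with hM
    have hMpos : (0:ℝ) < (M:ℝ) := by positivity
    have t1 : Tendsto (fun n : ℕ => ((n / M : ℕ) : ℝ) / (n : ℝ)) atTop (nhds ((M:ℝ)⁻¹)) := by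
      have := (tendsto_nat_floor_mul_div_atTop (R := ℝ) (a := (M:ℝ)⁻¹) (by positivity)).comp
        tendsto_natCast_atTop_atTop
      refine this.congr ?_
      intro n
      simp only [Function.comp]
      congr 2
      rw [← Nat.floor_div_eq_div (K := ℝ) n M]
      congr 1
      field_simp
    have t2 : Tendsto (fun n : ℕ => (a (m+1) : ℝ) * (((n / M : ℕ) : ℝ) / (n : ℝ)) ^ d) atTop
        (nhds (b m)) := by
      have := (t1.pow d).const_mul (a (m+1) : ℝ)
      refine this.trans (le_of_eq ?_)
      congr 1
      rw [hb]
      simp only [← hM]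
      rw [inv_pow, div_eq_mul_inv]
    filter_upwards [t2.eventually (lt_mem_nhds hm), eventually_ge_atTop M] with n hn hnM
    refine hn.trans_le ?_
    rw [div_pow, ← mul_div_assoc]
    gcongr
    have hq : 1 ≤ n / M := (Nat.one_le_div_iff (by omega)).2 hnM
    have hle : n / M * M ≤ n := Nat.div_mul_le_self n M
    have hexp : n / M * M = n / M * (m+1) + (d+1) * (n/M) := by rw [hM]; ring
    have := hs (m+1) (n/M) (n - n/M * (m+1)) (by omega) hq (by omega)
    rw [show n / M * (m+1) + (n - n/M * (m+1)) = n by omega] at this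
    exact_mod_cast this
  · intro x hx
    have t1 : Tendsto (fun n : ℕ => ((n + (d + 1) : ℝ)) / (n : ℝ)) atTop (nhds 1) := by
      have h := (tendsto_const_div_atTop_nhds_zero_nat ((d:ℝ)+1)).const_add 1
      rw [add_zero] at h
      refine h.congr' ?_
      filter_upwards [eventually_ge_atTop 1] with n hn
      have : (n:ℝ) ≠ 0 := by positivity
      field_simp
    have t2 : Tendsto (fun n : ℕ => L * (((n + (d + 1) : ℝ)) / (n : ℝ)) ^ d) atTop (nhds L) := by
      simpa using (t1.pow d).const_mul L
    filter_upwards [t2.eventually (gt_mem_nhds hx), eventually_ge_atTop 1] with n hn h1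
    refine lt_of_le_of_lt ?_ hn
    obtain ⟨m, rfl⟩ : ∃ m, n = m + 1 := ⟨n - 1, by omega⟩
    have := hLb m
    rw [hb] at this
    simp only at this
    rw [div_le_iff₀ (by positivity)] at this
    rw [div_pow, ← mul_div_assoc]
    gcongr
    push_cast at this ⊢
    exact this

section Leaf
variable {k L : Type} [Field k] [Field L] [Algebra k L] {s : ℕ}

/-- Power series all of whose coefficients below `w` (lexicographically) vanish. -/
def lowSub (k : Type) {L : Type} [Field k] [Field L] [Algebra k L] {s : ℕ} (w : Fin s →₀ ℕ) :
    Submodule k (MvPowerSeries (Fin s) L) where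
  carrier := {f | ∀ u : Fin s →₀ ℕ, toLex u < toLex w → MvPowerSeries.coeff u f = 0}
  add_mem' := by
    intro f g hf hg u hu
    rw [map_add, hf u hu, hg u hu, add_zero]
  zero_mem' := by
    intro u _
    simp
  smul_mem' := by
    intro c f hf u hu
    have : MvPowerSeries.coeff u (c • f) = c • MvPowerSeries.coeff u f := rfl
    rw [this, hf u hu, smul_zero]

/-- The coefficient map as a `k`-linear map. -/
def coeffk (k : Type) {L : Type} [Field k] [Field L] [Algebra k L] {s : ℕ} (w : Fin s →₀ ℕ) :
    MvPowerSeries (Fin s) L →ₗ[k] L where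
  toFun f := MvPowerSeries.coeff w f
  map_add' f g := by simp
  map_smul' c f := rfl

/-- Leading coefficients at exponent `w`. -/
def leaf (W : Submodule k (MvPowerSeries (Fin s) L)) (w : Fin s →₀ ℕ) : Submodule k L :=
  (W ⊓ lowSub k w).map (coeffk k w)

theorem mem_lowSub_iff (w : Fin s →₀ ℕ) (f : MvPowerSeries (Fin s) L) :
    f ∈ lowSub k w ↔ ((toLex w : Lex (Fin s →₀ ℕ)) : WithTop (Lex (Fin s →₀ ℕ))) ≤ MvPowerSeries.lexOrder f := by
  rw [MvPowerSeries.le_lexOrder_iff]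
  constructor
  · intro h d hd
    exact h d (by exact_mod_cast hd)
  · intro h u hu
    exact h u (by exact_mod_cast hu)

theorem mul_mem_lowSub {w w' : Fin s →₀ ℕ} {f g : MvPowerSeries (Fin s) L}
    (hf : f ∈ lowSub k w) (hg : g ∈ lowSub k w') : f * g ∈ lowSub k (w + w') := by
  rw [mem_lowSub_iff] at *
  refine le_trans ?_ (MvPowerSeries.le_lexOrder_mul f g)
  rw [toLex_add, WithTop.coe_add]
  exact add_le_add hf hg

theorem lexOrder_eq {w : Fin s →₀ ℕ} {f : MvPowerSeries (Fin s) L}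
    (hf : f ∈ lowSub k w) (h : MvPowerSeries.coeff w f ≠ 0) :
    MvPowerSeries.lexOrder f = toLex w :=
  le_antisymm (MvPowerSeries.lexOrder_le_of_coeff_ne_zero h) ((mem_lowSub_iff w f).1 hf)

theorem mem_leaf {W : Submodule k (MvPowerSeries (Fin s) L)} {w : Fin s →₀ ℕ} {x : L} :
    x ∈ leaf W w ↔ ∃ f ∈ W, f ∈ lowSub k w ∧ MvPowerSeries.coeff w f = x := by
  unfold leaf
  rw [Submodule.mem_map]
  constructor
  · rintro ⟨f, ⟨h1, h2⟩, h3⟩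
    exact ⟨f, h1, h2, h3⟩
  · rintro ⟨f, h1, h2, h3⟩
    exact ⟨f, ⟨h1, h2⟩, h3⟩

theorem leaf_ne_bot {W : Submodule k (MvPowerSeries (Fin s) L)} {w : Fin s →₀ ℕ} :
    leaf W w ≠ ⊥ ↔ ∃ f ∈ W, f ∈ lowSub k w ∧ MvPowerSeries.coeff w f ≠ 0 := by
  rw [Submodule.ne_bot_iff]
  constructor
  · rintro ⟨x, hx, h0⟩
    obtain ⟨f, h1, h2, rfl⟩ := mem_leaf.1 hx
    exact ⟨f, h1, h2, h0⟩
  · rintro ⟨f, h1, h2, h3⟩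
    exact ⟨_, mem_leaf.2 ⟨f, h1, h2, rfl⟩, h3⟩

theorem leaf_ne_bot_of_mem {W : Submodule k (MvPowerSeries (Fin s) L)} {f} (hf : f ∈ W)
    {w : Fin s →₀ ℕ} (h : MvPowerSeries.lexOrder f = toLex w) : leaf W w ≠ ⊥ :=
  leaf_ne_bot.2 ⟨f, hf, (mem_lowSub_iff w f).2 h.ge, MvPowerSeries.coeff_ne_zero_of_lexOrder h.symm⟩

theorem coeff_mul_leaf {w w' : Fin s →₀ ℕ} {f g : MvPowerSeries (Fin s) L}
    (hf : f ∈ lowSub k w) (hf0 : MvPowerSeries.coeff w f ≠ 0)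
    (hg : g ∈ lowSub k w') :
    MvPowerSeries.coeff (w + w') (f * g) = MvPowerSeries.coeff w f * MvPowerSeries.coeff w' g := by
  by_cases h : MvPowerSeries.coeff w' g = 0
  · rw [h, mul_zero]
    by_cases hg0 : g = 0
    · simp [hg0]
    apply MvPowerSeries.coeff_eq_zero_of_lt_lexOrder
    rw [MvPowerSeries.lexOrder_mul, lexOrder_eq hf hf0]
    obtain ⟨p, hp⟩ := MvPowerSeries.exists_finsupp_eq_lexOrder_of_ne_zero hg0
    have h1 := (mem_lowSub_iff w' g).1 hg
    rw [hp] at h1 ⊢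
    have h2 : w' ≠ p := by
      rintro rfl
      exact MvPowerSeries.coeff_ne_zero_of_lexOrder hp.symm h
    have h3 : toLex w' < toLex p := lt_of_le_of_ne (by exact_mod_cast h1) (by simpa using h2)
    rw [toLex_add]
    have : toLex w + toLex w' < toLex w + toLex p := by gcongr
    exact_mod_cast this
  · exact MvPowerSeries.coeff_mul_of_add_lexOrder (lexOrder_eq hf hf0) (lexOrder_eq hg h)

theorem finrank_eq_sum_leaf [FiniteDimensional k L] (n : ℕ) :
    ∀ (W : Submodule k (MvPowerSeries (Fin s) L)), FiniteDimensional k W → Module.finrank k W = n →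
    ∃ S : Finset (Fin s →₀ ℕ), (∀ w, w ∈ S ↔ leaf W w ≠ ⊥) ∧
      Module.finrank k W = ∑ w ∈ S, Module.finrank k (leaf W w) := by
  classical
  induction n using Nat.strong_induction_on with
  | _ n ih =>
  intro W hW hn
  by_cases hbot : W = ⊥
  · subst hbot
    refine ⟨∅, ?_, ?_⟩
    · intro w
      simp [leaf]
    · simp
  -- minimal exponent
  set T : Set (Lex (Fin s →₀ ℕ)) := {w | leaf W (ofLex w) ≠ ⊥} with hT
  have hTne : T.Nonempty := by
    obtain ⟨f, hf, hf0⟩ := (Submodule.ne_bot_iff _).1 hbot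
    obtain ⟨p, hp⟩ := MvPowerSeries.exists_finsupp_eq_lexOrder_of_ne_zero hf0
    exact ⟨toLex p, leaf_ne_bot_of_mem hf hp⟩
  obtain ⟨w0, hw0, hmin⟩ := WellFounded.has_min (wellFounded_lt (α := Lex (Fin s →₀ ℕ))) T hTne
  obtain ⟨w0, rfl⟩ := toLex.surjective w0
  have hlow : ∀ f ∈ W, f ∈ lowSub k w0 := by
    intro f hf
    by_cases hf0 : f = 0
    · rw [hf0]; exact Submodule.zero_mem _
    obtain ⟨p, hp⟩ := MvPowerSeries.exists_finsupp_eq_lexOrder_of_ne_zero hf0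
    have := hmin (toLex p) (leaf_ne_bot_of_mem hf hp)
    rw [mem_lowSub_iff, hp]
    exact_mod_cast not_lt.1 this
  set W' := W ⊓ LinearMap.ker (coeffk k (L := L) w0) with hW'
  have hW'fd : FiniteDimensional k W' := Submodule.finiteDimensional_inf_left _ _
  have hrk : Module.finrank k W = Module.finrank k W' + Module.finrank k (leaf W w0) := by
    have h1 := LinearMap.finrank_range_add_finrank_ker ((coeffk k (L := L) w0).domRestrict W)
    have h2 : LinearMap.range ((coeffk k (L := L) w0).domRestrict W) = leaf W w0 := by
      unfold leaf
      rw [inf_eq_left.2 (show W ≤ lowSub k w0 from hlow), LinearMap.range_domRestrict]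
    have h3 : Module.finrank k (LinearMap.ker ((coeffk k (L := L) w0).domRestrict W))
        = Module.finrank k W' := by
      rw [LinearMap.ker_domRestrict, hW']
      have := (Submodule.comapSubtypeEquivOfLe (p := W ⊓ LinearMap.ker (coeffk k (L := L) w0)) (q := W) inf_le_left).finrank_eq
      rw [← this]
      congr 2
      all_goals simp [Submodule.comap_inf]
    rw [h2, h3] at h1
    omega
  have hpos : 0 < Module.finrank k (leaf W w0) := by
    have : Nontrivial (leaf W w0) := Submodule.nontrivial_iff_ne_bot.2 hw0
    exact Module.finrank_pos
  obtain ⟨S, hS, hsum⟩ := ih (Module.finrank k W') (by omega) W' hW'fd rfl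
  have hw0S : w0 ∉ S := by
    rw [hS, leaf_ne_bot]
    rintro ⟨f, hf, -, h⟩
    exact h hf.2
  have hleaf : ∀ w, w ≠ w0 → leaf W' w = leaf W w := by
    intro w hw
    refine le_antisymm (Submodule.map_mono (inf_le_inf_right _ inf_le_left)) ?_
    intro x hx
    by_cases hx0 : x = 0
    · rw [hx0]; exact Submodule.zero_mem _
    obtain ⟨f, h1, h2, rfl⟩ := mem_leaf.1 hx
    refine mem_leaf.2 ⟨f, ⟨h1, ?_⟩, h2, rfl⟩
    have h3 := hlow f h1
    have h4 : toLex w0 ≤ toLex w := by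
      rw [mem_lowSub_iff, lexOrder_eq h2 hx0] at h3
      exact_mod_cast h3
    exact h2 w0 (lt_of_le_of_ne h4 (by simpa using hw.symm))
  refine ⟨insert w0 S, ?_, ?_⟩
  · intro w
    rw [Finset.mem_insert]
    by_cases hw : w = w0
    · subst hw
      exact ⟨fun _ => hw0, fun _ => Or.inl rfl⟩
    · rw [hS, hleaf w hw]
      simp [hw]
  · rw [Finset.sum_insert hw0S, hrk, hsum, add_comm]
    congr 1
    refine Finset.sum_congr rfl fun w hw => ?_
    rw [hleaf w]
    rintro rfl
    exact hw0S hw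
end Leaf

theorem series_limit {k L : Type} [Field k] [Field L] [Algebra k L] [FiniteDimensional k L] {s : ℕ}
    (W : ℕ → Submodule k (MvPowerSeries (Fin s) L))
    (hfd : ∀ n, 1 ≤ n → FiniteDimensional k (W n))
    (hmul : ∀ m n, 1 ≤ m → 1 ≤ n → ∀ f ∈ W m, ∀ g ∈ W n, f * g ∈ W (m + n))
    (F : MvPowerSeries (Fin s) L) (hF : F ≠ 0)
    (hFW : ∀ n, 1 ≤ n → ∀ w : Fin s →₀ ℕ, (∑ i, w i) ≤ n →
      F ^ n * MvPowerSeries.monomial w 1 ∈ W n)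
    (B : ℝ) (hB : ∀ n, 1 ≤ n → (Module.finrank k (W n) : ℝ) ≤ B * (n : ℝ) ^ s) :
    ∃ l : ℝ, Tendsto (fun n : ℕ => (Module.finrank k (W n) : ℝ) / (n : ℝ) ^ s) atTop (nhds l) := by
  classical
  have key : ∀ n, ∃ S : Finset (Fin s →₀ ℕ), 1 ≤ n → ((∀ w, w ∈ S ↔ leaf (W n) w ≠ ⊥) ∧
      Module.finrank k (W n) = ∑ w ∈ S, Module.finrank k (leaf (W n) w)) := by
    intro n
    by_cases hn : 1 ≤ n
    · obtain ⟨S, h⟩ := finrank_eq_sum_leaf _ (W n) (hfd n hn) rfl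
      exact ⟨S, fun _ => h⟩
    · exact ⟨∅, fun h => absurd h hn⟩
  choose T hT using key
  have hTmem : ∀ n, 1 ≤ n → ∀ w, w ∈ T n ↔ leaf (W n) w ≠ ⊥ := fun n hn => (hT n hn).1
  have hTsum : ∀ n, 1 ≤ n → Module.finrank k (W n) = ∑ w ∈ T n, Module.finrank k (leaf (W n) w) :=
    fun n hn => (hT n hn).2
  have hleafpos : ∀ n, 1 ≤ n → ∀ w ∈ T n, 1 ≤ Module.finrank k (leaf (W n) w) := by
    intro n hn w hw
    have : Nontrivial (leaf (W n) w) := Submodule.nontrivial_iff_ne_bot.2 ((hTmem n hn w).1 hw)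
    exact Module.finrank_pos
  -- leaves grow under multiplication
  have hgrow : ∀ m n, 1 ≤ m → 1 ≤ n → ∀ w ∈ T m, ∀ w',
      Module.finrank k (leaf (W n) w') ≤ Module.finrank k (leaf (W (m + n)) (w + w')) := by
    intro m n hm hn w hw w'
    obtain ⟨f, hf, hlow, h0⟩ := leaf_ne_bot.1 ((hTmem m hm w).1 hw)
    set c := MvPowerSeries.coeff w f with hc
    have hinj : Function.Injective (LinearMap.mulLeft k c) := by
      intro x y hxy
      exact mul_left_cancel₀ h0 hxy
    have hle : (leaf (W n) w').map (LinearMap.mulLeft k c) ≤ leaf (W (m + n)) (w + w') := by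
      rintro _ ⟨x, hx, rfl⟩
      obtain ⟨g, hg, hglow, rfl⟩ := mem_leaf.1 hx
      exact mem_leaf.2 ⟨f * g, hmul m n hm hn f hf g hg, mul_mem_lowSub hlow hglow,
        coeff_mul_leaf hlow h0 hglow⟩
    calc Module.finrank k (leaf (W n) w')
        = Module.finrank k ((leaf (W n) w').map (LinearMap.mulLeft k c)) :=
          (LinearEquiv.finrank_eq (Submodule.equivMapOfInjective _ hinj _))
      _ ≤ _ := Submodule.finrank_mono hle
  have hadd : ∀ m n, 1 ≤ m → 1 ≤ n → ∀ w ∈ T m, ∀ w' ∈ T n, w + w' ∈ T (m + n) := by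
    intro m n hm hn w hw w' hw'
    have h1 := hgrow m n hm hn w hw w'
    have h2 := hleafpos n hn w' hw'
    rw [hTmem _ (by omega)]
    intro h
    rw [h, finrank_bot] at h1
    omega
  have hnsmul : ∀ m, 1 ≤ m → ∀ w ∈ T m, ∀ q, q • w + w ∈ T (q * m + m) := by
    intro m hm w hw q
    induction q with
    | zero => simpa using hw
    | succ q ih =>
      have := hadd (q * m + m) m (by omega) hm _ ih w hw
      rw [show (q + 1) * m + m = q * m + m + m by ring, add_smul, one_smul]
      exact this
  obtain ⟨u, hu⟩ := MvPowerSeries.exists_finsupp_eq_lexOrder_of_ne_zero hF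
  have hpow : ∀ n : ℕ, MvPowerSeries.lexOrder (F ^ n) = toLex (n • u) := by
    intro n
    induction n with
    | zero =>
      rw [pow_zero, zero_smul]
      apply lexOrder_eq (k := k)
      · intro v hv
        exact absurd hv (not_lt.2 (bot_le (a := toLex v)))
      · simp
    | succ n ih =>
      rw [pow_succ, MvPowerSeries.lexOrder_mul, ih, hu, add_smul, one_smul, toLex_add, WithTop.coe_add]
  have hmono : ∀ w : Fin s →₀ ℕ,
      MvPowerSeries.lexOrder (MvPowerSeries.monomial w (1 : L)) = toLex w := by
    intro w
    apply lexOrder_eq (k := k)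
    · intro v hv
      rw [MvPowerSeries.coeff_monomial_ne]
      rintro rfl
      exact lt_irrefl _ hv
    · simp
  have hu_mem : ∀ n, 1 ≤ n → ∀ w : Fin s →₀ ℕ, (∑ i, w i) ≤ n → n • u + w ∈ T n := by
    intro n hn w hw
    rw [hTmem n hn]
    apply leaf_ne_bot_of_mem (hFW n hn w hw)
    rw [MvPowerSeries.lexOrder_mul, hpow, hmono, toLex_add, WithTop.coe_add]
  -- count
  set a : ℕ → ℕ := fun n => (T n).card with ha
  have hacard : ∀ n, 1 ≤ n → a n ≤ Module.finrank k (W n) := by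
    intro n hn
    rw [hTsum n hn, ha]
    simp only
    rw [Finset.card_eq_sum_ones]
    exact Finset.sum_le_sum (hleafpos n hn)
  obtain ⟨l, hl⟩ := lim_of_superadd a s B
    (fun n hn => le_trans (by exact_mod_cast hacard n hn) (hB n hn)) (by
      intro m q r hm hq hr
      have hcard : a m * q ^ s = (T m ×ˢ (Finset.univ : Finset (Fin s → Fin q))).card := by
        simp [ha]
      rw [hcard]
      apply Finset.card_le_card_of_injOn
        (fun p => q • p.1 + (r • u + Finsupp.equivFunOnFinite.symm (fun i => (p.2 i : ℕ))))
      · rintro ⟨w, c⟩ hp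
        simp only [Finset.coe_product, Set.mem_prod, Finset.mem_coe] at hp
        obtain ⟨q', rfl⟩ : ∃ q', q = q' + 1 := ⟨q - 1, by omega⟩
        have h1 := hnsmul m hm w hp.1 q'
        have hr1 : 1 ≤ r := le_trans (by nlinarith) hr
        have h2 := hu_mem r hr1 (Finsupp.equivFunOnFinite.symm (fun i => (c i : ℕ))) (by
          calc ∑ i, (c i : ℕ) ≤ ∑ i : Fin s, (q' + 1) := Finset.sum_le_sum fun i _ => (c i).2.le
            _ = s * (q' + 1) := by simp
            _ ≤ r := le_trans (by nlinarith) hr)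
        have := hadd _ _ (by omega) hr1 _ h1 _ h2
        simp only [Finset.mem_coe]
        rw [show (q' + 1) * m + r = q' * m + m + r by ring, add_smul, one_smul]
        exact this
      · rintro ⟨w, c⟩ - ⟨w', c'⟩ - h
        simp only at h
        have h' : ∀ i, q * w i + c i = q * w' i + c' i := by
          intro i
          have := DFunLike.congr_fun h i
          simp at this
          omega
        have hqpos : 0 < q := hq
        have hc : ∀ i, c i = c' i := by
          intro i
          apply Fin.ext
          have := congrArg (· % q) (h' i)
          simpa [Nat.mul_add_mod, Nat.mod_eq_of_lt (c i).2, Nat.mod_eq_of_lt (c' i).2] using this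
        have hw : ∀ i, w i = w' i := by
          intro i
          have h1 := h' i
          rw [hc i] at h1
          exact Nat.eq_of_mul_eq_mul_left hqpos (Nat.add_right_cancel h1)
        exact Prod.ext (Finsupp.ext hw) (funext hc))
  -- maximal leaf dimension
  have hmax : ∃ t : ℕ, (∃ n0 w0, 1 ≤ n0 ∧ Module.finrank k (leaf (W n0) w0) = t) ∧
      ∀ n w, 1 ≤ n → Module.finrank k (leaf (W n) w) ≤ t := by
    have hbd : ∀ n w, Module.finrank k (leaf (W n) w) ≤ Module.finrank k L :=
      fun n w => Submodule.finrank_le _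
    set P : ℕ → Prop := fun t => ∃ n0 w0, 1 ≤ n0 ∧ Module.finrank k (leaf (W n0) w0) = t with hP
    have hP1 : P (Module.finrank k (leaf (W 1) 0)) := ⟨1, 0, le_rfl, rfl⟩
    refine ⟨Nat.findGreatest P (Module.finrank k L), Nat.findGreatest_spec (hbd 1 0) hP1, ?_⟩
    intro n w hn
    exact Nat.le_findGreatest (hbd n w) ⟨n, w, hn, rfl⟩
  obtain ⟨t, ⟨n0, w0, hn0, ht⟩, htmax⟩ := hmax
  refine ⟨t * l, ?_⟩
  have hupper : ∀ n, 1 ≤ n → Module.finrank k (W n) ≤ t * a n := by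
    intro n hn
    rw [hTsum n hn, mul_comm, ha]
    simp only
    rw [← smul_eq_mul]
    exact Finset.sum_le_card_nsmul _ _ _ fun w _ => htmax n w hn
  have hlower : ∀ n, 1 ≤ n → t * a n ≤ Module.finrank k (W (n + n0)) := by
    intro n hn
    by_cases ht0 : t = 0
    · simp [ht0]
    rw [hTsum (n + n0) (by omega)]
    have hinj : Set.InjOn (fun w => w + w0) (T n : Set (Fin s →₀ ℕ)) :=
      fun x _ y _ h => add_right_cancel h
    calc t * a n = ∑ w ∈ T n, t := by simp [ha, mul_comm]
      _ ≤ ∑ w ∈ T n, Module.finrank k (leaf (W (n + n0)) (w + w0)) := by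
          refine Finset.sum_le_sum fun w hw => ?_
          rw [← ht]
          exact hgrow n n0 hn hn0 w hw w0
      _ = ∑ w ∈ (T n).image (fun w => w + w0), Module.finrank k (leaf (W (n + n0)) w) := by
          rw [Finset.sum_image hinj]
      _ ≤ _ := by
          refine Finset.sum_le_sum_of_subset ?_
          intro x hx
          obtain ⟨w, hw, rfl⟩ := Finset.mem_image.1 hx
          have h1 := hgrow n n0 hn hn0 w hw w0
          rw [hTmem _ (by omega)]
          intro h
          rw [h, finrank_bot] at h1
          omega
  rw [← tendsto_add_atTop_iff_nat n0]
  have hratio : Tendsto (fun n : ℕ => (n : ℝ) / ((n + n0 : ℕ) : ℝ)) atTop (nhds 1) := by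
    have := tendsto_natCast_div_add_atTop (𝕜 := ℝ) (n0 : ℝ)
    simpa using this
  have hlow : Tendsto (fun n : ℕ => (t : ℝ) * ((a n : ℝ) / (n : ℝ) ^ s *
      ((n : ℝ) / ((n + n0 : ℕ) : ℝ)) ^ s)) atTop (nhds (t * l)) := by
    have := (hl.mul (hratio.pow s)).const_mul (t : ℝ)
    simpa using this
  have hup : Tendsto (fun n : ℕ => (t : ℝ) * ((a (n + n0) : ℝ) / ((n + n0 : ℕ) : ℝ) ^ s)) atTop
      (nhds (t * l)) :=
    ((tendsto_add_atTop_iff_nat n0).2 hl).const_mul (t : ℝ)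
  refine tendsto_of_tendsto_of_tendsto_of_le_of_le' hlow hup ?_ ?_
  · filter_upwards [eventually_ge_atTop 1] with n hn
    have hnz : (n : ℝ) ≠ 0 := by positivity
    have h1 : (t : ℝ) * ((a n : ℝ) / (n : ℝ) ^ s * ((n : ℝ) / ((n + n0 : ℕ) : ℝ)) ^ s)
        = (t * a n : ℕ) / ((n + n0 : ℕ) : ℝ) ^ s := by
      rw [div_pow]
      push_cast
      field_simp
    rw [h1]
    gcongr
    exact hlower n hn
  · filter_upwards [eventually_ge_atTop 1] with n hn
    rw [← mul_div_assoc]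
    gcongr
    exact_mod_cast hupper (n + n0) (by omega)

theorem dim_le_of_noether {k R : Type} [Field k] [CommRing R] [IsDomain R] {s : ℕ}
    [Algebra (MvPolynomial (Fin s) k) R] [Algebra.IsIntegral (MvPolynomial (Fin s) k) R]
    (hinj : Function.Injective (algebraMap (MvPolynomial (Fin s) k) R)) :
    ((s : ℕ∞) : WithBot ℕ∞) ≤ ringKrullDim R := by
  have h1 : ringKrullDim (MvPolynomial (Fin s) k) = ((s : ℕ∞) : WithBot ℕ∞) := by
    rw [MvPolynomial.ringKrullDim_of_isNoetherianRing, ringKrullDim_eq_zero_of_field]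
    simp
  rw [← h1]
  unfold ringKrullDim
  refine iSup_le fun l => ?_
  have hbot : RingHom.ker (algebraMap (MvPolynomial (Fin s) k) R) ≤ (RelSeries.head l).asIdeal := by
    rw [(RingHom.injective_iff_ker_eq_bot _).1 hinj]; exact bot_le
  obtain ⟨Q, -, hQ, hQ2⟩ := Ideal.exists_ideal_over_prime_of_isIntegral
    (RelSeries.head l).asIdeal (⊥ : Ideal R) hbot
  have : Q.LiesOver (RelSeries.head l).asIdeal := ⟨hQ2.symm⟩
  obtain ⟨L, hL, -⟩ := Ideal.exists_ltSeries_of_hasGoingUp l Q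
  rw [← hL]
  exact le_iSup (fun p : LTSeries (PrimeSpectrum R) => ((p.length : ℕ∞) : WithBot ℕ∞)) L

theorem mem_span_X_of_constantCoeff {L : Type} [Field L] {s : ℕ}
    (f : MvPowerSeries (Fin s) L) (hf : MvPowerSeries.constantCoeff f = 0) :
    f ∈ Ideal.span (Set.range (MvPowerSeries.X : Fin s → MvPowerSeries (Fin s) L)) := by
  classical
  let g : Fin s → MvPowerSeries (Fin s) L := fun i w =>
    if w i ≠ 0 ∧ ∀ j < i, w j = 0 then f w else 0
  have hg : ∀ i w, MvPowerSeries.coeff w (g i) =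
      if w i ≠ 0 ∧ ∀ j < i, w j = 0 then MvPowerSeries.coeff w f else 0 := fun _ _ => rfl
  have hsum : f = ∑ i, g i := by
    ext w
    rw [map_sum]
    by_cases hw : w = 0
    · subst hw
      have : ∀ i, MvPowerSeries.coeff 0 (g i) = 0 := by
        intro i
        rw [hg]
        simp
      simp only [this, Finset.sum_const_zero]
      simpa using hf
    · have hne : (Finset.univ.filter fun i => w i ≠ 0).Nonempty := by
        by_contra h
        apply hw
        ext i
        by_contra h2
        exact h ⟨i, by simpa using h2⟩
      set i0 := Finset.min' _ hne
      have hi0 : w i0 ≠ 0 := by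
        have := Finset.min'_mem _ hne
        simpa using (Finset.mem_filter.1 this).2
      have hmin : ∀ j < i0, w j = 0 := by
        intro j hj
        by_contra h2
        have := Finset.min'_le (Finset.univ.filter fun i => w i ≠ 0) j (by simpa using h2)
        exact absurd hj (not_lt.2 this)
      rw [Finset.sum_eq_single i0]
      · rw [hg, if_pos ⟨hi0, hmin⟩]
      · intro j _ hj
        rw [hg]
        rw [if_neg]
        rintro ⟨h1, h2⟩
        rcases lt_or_gt_of_ne hj with h | h
        · exact h1 (hmin j h)
        · exact hi0 (h2 _ h)
      · simp
  rw [hsum]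
  refine Ideal.sum_mem _ fun i _ => ?_
  have : MvPowerSeries.X i ∣ g i := by
    rw [MvPowerSeries.X_dvd_iff]
    intro w hw
    rw [hg]
    simp [hw]
  exact Ideal.mem_of_dvd _ this (Ideal.subset_span ⟨i, rfl⟩)

theorem hensel_series {L : Type} [Field L] {s : ℕ}
    (P : Polynomial (MvPowerSeries (Fin s) L)) (hP : P.Monic) (t : L)
    (h0 : (P.map MvPowerSeries.constantCoeff).eval t = 0)
    (h1 : (P.map MvPowerSeries.constantCoeff).derivative.eval t ≠ 0) :
    ∃ a : MvPowerSeries (Fin s) L, P.eval a = 0 := by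
  set J := Ideal.span (Set.range (MvPowerSeries.X : Fin s → MvPowerSeries (Fin s) L))
  have hc : ∀ Q : Polynomial (MvPowerSeries (Fin s) L),
      MvPowerSeries.constantCoeff (Q.eval (MvPowerSeries.C t)) =
        (Q.map MvPowerSeries.constantCoeff).eval t := by
    intro Q
    rw [← Polynomial.eval₂_hom, Polynomial.eval_map]
    simp
  obtain ⟨a, ha, -⟩ := HenselianRing.is_henselian (I := J) P hP (MvPowerSeries.C t)
    (mem_span_X_of_constantCoeff _ (by rw [hc, h0]))
    (by
      apply IsUnit.map
      rw [MvPowerSeries.isUnit_iff_constantCoeff, hc, ← Polynomial.derivative_map]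
      exact isUnit_iff_ne_zero.2 h1)
  exact ⟨a, ha⟩

noncomputable def shiftMap {k : Type} (L : Type) [Field k] [Field L] [Algebra k L] {s : ℕ}
    (a : Fin s → k) : MvPolynomial (Fin s) k →ₐ[k] MvPowerSeries (Fin s) L :=
  MvPolynomial.aeval fun i => algebraMap k (MvPowerSeries (Fin s) L) (a i) + MvPowerSeries.X i

theorem shiftMap_X {k : Type} (L : Type) [Field k] [Field L] [Algebra k L] {s : ℕ}
    (a : Fin s → k) (i : Fin s) : shiftMap L a (MvPolynomial.X i) =
      algebraMap k (MvPowerSeries (Fin s) L) (a i) + MvPowerSeries.X i := by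
  simp [shiftMap]

theorem shiftMap_const {k : Type} (L : Type) [Field k] [Field L] [Algebra k L] {s : ℕ}
    (a : Fin s → k) (p : MvPolynomial (Fin s) k) :
    MvPowerSeries.constantCoeff (shiftMap L a p) = algebraMap k L (MvPolynomial.eval a p) := by
  induction p using MvPolynomial.induction_on with
  | C c =>
    have : (MvPolynomial.C c : MvPolynomial (Fin s) k) = algebraMap k _ c := rfl
    rw [this, AlgHom.commutes]
    simp [MvPowerSeries.algebraMap_apply]
  | add p q hp hq => simp [hp, hq]
  | mul_X p i hp => simp [hp, shiftMap_X, MvPowerSeries.algebraMap_apply]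

theorem shiftMap_injective {k : Type} (L : Type) [Field k] [Field L] [Algebra k L] {s : ℕ}
    (a : Fin s → k) : Function.Injective (shiftMap L a) := by
  let t1 : MvPolynomial (Fin s) k →ₐ[k] MvPolynomial (Fin s) k :=
    MvPolynomial.aeval fun i => algebraMap k _ (a i) + MvPolynomial.X i
  let t2 : MvPolynomial (Fin s) k →ₐ[k] MvPolynomial (Fin s) k :=
    MvPolynomial.aeval fun i => MvPolynomial.X i - algebraMap k _ (a i)
  have h12 : t2.comp t1 = AlgHom.id k _ := by
    ext1 i
    simp [t1, t2]
  have ht1 : Function.Injective t1 := by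
    intro x y hxy
    have := congrArg t2 hxy
    rw [← AlgHom.comp_apply, ← AlgHom.comp_apply, h12] at this
    simpa using this
  have hco : ∀ p, shiftMap L a p =
      ((MvPolynomial.map (algebraMap k L) (t1 p) : MvPolynomial (Fin s) L) :
        MvPowerSeries (Fin s) L) := by
    intro p
    induction p using MvPolynomial.induction_on with
    | C c =>
      have : (MvPolynomial.C c : MvPolynomial (Fin s) k) = algebraMap k _ c := rfl
      rw [this, AlgHom.commutes, AlgHom.commutes]
      simp [MvPowerSeries.algebraMap_apply, MvPolynomial.algebraMap_eq]
    | add p q hp hq => simp [hp, hq]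
    | mul_X p i hp =>
      simp [hp, shiftMap_X, MvPowerSeries.algebraMap_apply, t1, MvPolynomial.algebraMap_eq]
  intro x y hxy
  rw [hco, hco] at hxy
  exact ht1 (MvPolynomial.map_injective _ (algebraMap k L).injective
    (MvPolynomial.coe_injective _ _ hxy))

theorem exists_root_data {k : Type} [Field k] [CharZero k] {s : ℕ}
    (P U V : Polynomial (MvPolynomial (Fin s) k)) (hP : P.Monic) (hdeg : 0 < P.natDegree)
    (g0 : MvPolynomial (Fin s) k) (hg0 : g0 ≠ 0)
    (hbez : U * P + V * P.derivative = Polynomial.C g0) :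
    ∃ (L : Type) (_ : Field L) (_ : Algebra k L) (_ : FiniteDimensional k L) (a : Fin s → k)
      (θ : MvPowerSeries (Fin s) L), P.eval₂ (shiftMap L a).toRingHom θ = 0 := by
  obtain ⟨a, ha⟩ : ∃ a : Fin s → k, MvPolynomial.eval a g0 ≠ 0 := by
    by_contra! h
    exact hg0 (MvPolynomial.funext fun a => by simpa using h a)
  set Pa := P.map (MvPolynomial.eval a) with hPa
  have hPam : Pa.Monic := hP.map _
  have hPad : Pa.natDegree = P.natDegree := hP.natDegree_map _
  have hnu : ¬ IsUnit Pa := by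
    intro h
    have := Polynomial.natDegree_eq_zero_of_isUnit h
    omega
  obtain ⟨L, _, _, hfd, t, ht⟩ : ∃ (L : Type) (_ : Field L) (_ : Algebra k L)
      (_ : FiniteDimensional k L) (t : L), Pa.eval₂ (algebraMap k L) t = 0 := by
    obtain ⟨q, hq⟩ : Pa.factor ∣ Pa := Polynomial.factor_dvd_of_not_isUnit hnu
    have : Fact (Irreducible Pa.factor) := Polynomial.fact_irreducible_factor _
    have hne : Pa.factor ≠ 0 := this.out.ne_zero
    generalize Pa.factor = F at this hne hq
    have h : F.eval₂ (algebraMap k (AdjoinRoot F)) (AdjoinRoot.root F) = 0 :=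
      AdjoinRoot.eval₂_root _
    refine ⟨AdjoinRoot F, inferInstance, inferInstance, (AdjoinRoot.powerBasis hne).finite,
      AdjoinRoot.root F, ?_⟩
    rw [hq, Polynomial.eval₂_mul, h, zero_mul]
  have ht' : Pa.derivative.eval₂ (algebraMap k L) t ≠ 0 := by
    intro h
    have h2 := congrArg (fun Q => (Q.map (MvPolynomial.eval a)).eval₂ (algebraMap k L) t) hbez
    simp only [Polynomial.map_add, Polynomial.map_mul, Polynomial.eval₂_add, Polynomial.eval₂_mul,
      ← Polynomial.derivative_map, ← hPa, ht, h, mul_zero, add_zero, Polynomial.map_C,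
      Polynomial.eval₂_C] at h2
    exact ha ((algebraMap k L).injective (by rw [← h2, map_zero]))
  have hmap : (P.map (shiftMap L a).toRingHom).map MvPowerSeries.constantCoeff =
      Pa.map (algebraMap k L) := by
    rw [hPa, Polynomial.map_map, Polynomial.map_map]
    congr 1
    refine RingHom.ext fun x => ?_
    simp [shiftMap_const]
  obtain ⟨θ, hθ⟩ := hensel_series (P.map (shiftMap L a).toRingHom) (hP.map _) t
    (by rw [hmap, Polynomial.eval_map, ht])
    (by rw [hmap, Polynomial.derivative_map, Polynomial.eval_map]; exact ht')
  exact ⟨L, inferInstance, inferInstance, hfd, a, θ, by rw [← Polynomial.eval_map]; exact hθ⟩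

theorem exists_bezout {k : Type} [Field k] [CharZero k] {s : ℕ} {K : Type} [Field K]
    [Algebra (MvPolynomial (Fin s) k) K]
    [Algebra (FractionRing (MvPolynomial (Fin s) k)) K]
    [IsScalarTower (MvPolynomial (Fin s) k) (FractionRing (MvPolynomial (Fin s) k)) K]
    [FiniteDimensional (FractionRing (MvPolynomial (Fin s) k)) K] :
    ∃ (θ : K) (P U V : Polynomial (MvPolynomial (Fin s) k)) (g0 : MvPolynomial (Fin s) k),
      IntermediateField.adjoin (FractionRing (MvPolynomial (Fin s) k)) {θ} = ⊤ ∧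
      P.Monic ∧ 0 < P.natDegree ∧ g0 ≠ 0 ∧
      minpoly (FractionRing (MvPolynomial (Fin s) k)) θ = P.map (algebraMap _ _) ∧
      U * P + V * P.derivative = Polynomial.C g0 := by
  set A := MvPolynomial (Fin s) k
  set FA := FractionRing A
  have : CharZero FA := by
    have : CharZero A := inferInstance
    exact IsFractionRing.charZero A
  obtain ⟨θ0, hθ0⟩ := Field.exists_primitive_element FA K
  have halg : IsAlgebraic A θ0 :=
    (IsFractionRing.isAlgebraic_iff A FA K).2 (Algebra.IsAlgebraic.isAlgebraic θ0)
  obtain ⟨y, hy, hint⟩ := halg.exists_integral_multiple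
  have hinjK : Function.Injective (algebraMap A K) := by
    rw [IsScalarTower.algebraMap_eq A FA K]
    exact (algebraMap FA K).injective.comp (IsFractionRing.injective A FA)
  have : FaithfulSMul A K := (faithfulSMul_iff_algebraMap_injective A K).2 hinjK
  set θ := y • θ0 with hθ
  have htop : IntermediateField.adjoin FA {θ} = ⊤ := by
    rw [eq_top_iff, ← hθ0, IntermediateField.adjoin_simple_le_iff]
    have hyK : algebraMap A K y ≠ 0 := by
      rw [Ne, map_eq_zero_iff _ hinjK]; exact hy
    have h1 : θ0 = (algebraMap FA K (algebraMap A FA y))⁻¹ * θ := by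
      rw [hθ, Algebra.smul_def, ← IsScalarTower.algebraMap_apply]
      field_simp
    rw [h1]
    exact mul_mem (inv_mem (IntermediateField.algebraMap_mem _ _))
      (IntermediateField.mem_adjoin_simple_self _ _)
  have hmin : minpoly FA θ = (minpoly A θ).map (algebraMap A FA) :=
    minpoly.isIntegrallyClosed_eq_field_fractions FA K hint
  have hsep : (minpoly FA θ).Separable := Algebra.IsSeparable.isSeparable FA θ
  obtain ⟨u, v, huv⟩ := hsep
  obtain ⟨bu, hbu, hu⟩ := IsLocalization.integerNormalization_spec (nonZeroDivisors A) u
  obtain ⟨bv, hbv, hv⟩ := IsLocalization.integerNormalization_spec (nonZeroDivisors A) v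
  set u1 := IsLocalization.integerNormalization (nonZeroDivisors A) u
  set v1 := IsLocalization.integerNormalization (nonZeroDivisors A) v
  refine ⟨θ, minpoly A θ, Polynomial.C bv * u1, Polynomial.C bu * v1, bu * bv, htop,
    minpoly.monic hint, minpoly.natDegree_pos hint, ?_, hmin, ?_⟩
  · exact mul_ne_zero (nonZeroDivisors.ne_zero hbu) (nonZeroDivisors.ne_zero hbv)
  · apply Polynomial.map_injective _ (IsFractionRing.injective A FA)
    have hu' : u1.map (algebraMap A FA) = Polynomial.C (algebraMap A FA bu) * u := by
      rw [hu, Algebra.smul_def]; rfl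
    have hv' : v1.map (algebraMap A FA) = Polynomial.C (algebraMap A FA bv) * v := by
      rw [hv, Algebra.smul_def]; rfl
    simp only [Polynomial.map_add, Polynomial.map_mul, Polynomial.map_C, hu', hv',
      ← Polynomial.derivative_map, ← hmin, map_mul]
    linear_combination (Polynomial.C (algebraMap A FA bu) * Polynomial.C (algebraMap A FA bv)) * huv

theorem exists_embedding {k R : Type} [Field k] [CharZero k] [CommRing R] [IsDomain R] {s : ℕ}
    [Algebra (MvPolynomial (Fin s) k) R] [Module.Finite (MvPolynomial (Fin s) k) R]
    (hinj : Function.Injective (algebraMap (MvPolynomial (Fin s) k) R)) :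
    ∃ (L : Type) (_ : Field L) (_ : Algebra k L) (_ : FiniteDimensional k L) (a : Fin s → k)
      (ψ : R → MvPowerSeries (Fin s) L) (h : MvPowerSeries (Fin s) L),
      h ≠ 0 ∧ Function.Injective ψ ∧ (∀ x y, ψ (x + y) = ψ x + ψ y) ∧
      (∀ x y, h * ψ (x * y) = ψ x * ψ y) ∧
      (∀ (r : MvPolynomial (Fin s) k) x, ψ (algebraMap _ R r * x) = shiftMap L a r * ψ x) := by
  set A := MvPolynomial (Fin s) k with hA
  have : FaithfulSMul A R := (faithfulSMul_iff_algebraMap_injective A R).2 hinj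
  set FA := FractionRing A with hFA
  set K := FractionRing R with hK
  have : FaithfulSMul A K := by
    rw [faithfulSMul_iff_algebraMap_injective, IsScalarTower.algebraMap_eq A R K]
    exact (IsFractionRing.injective R K).comp hinj
  let _ : Algebra FA K := FractionRing.liftAlgebra A K
  have : IsScalarTower A FA K := FractionRing.isScalarTower_liftAlgebra A K
  have : FiniteDimensional FA K := .of_isLocalization A R (nonZeroDivisors A)
  obtain ⟨θ, P, U, V, g0, htop, hPm, hPd, hg0, hmin, hbez⟩ := exists_bezout (k := k) (s := s) (K := K)
  obtain ⟨L, _, _, hfd, a, t, ht⟩ := exists_root_data P U V hPm hPd g0 hg0 hbez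
  let C := MvPowerSeries (Fin s) L
  let FC := FractionRing C
  let ι : A →+* C := (shiftMap L a).toRingHom
  have hι : Function.Injective ((algebraMap C FC).comp ι) :=
    (IsFractionRing.injective C FC).comp (shiftMap_injective L a)
  let _ : Algebra FA FC := (IsFractionRing.lift (A := A) (K := FA) hι).toAlgebra
  have hlift : ∀ r : A, algebraMap FA FC (algebraMap A FA r) = algebraMap C FC (ι r) := by
    intro r
    exact IsFractionRing.lift_algebraMap hι r
  have hroot : algebraMap C FC t ∈ (minpoly FA θ).aroots FC := by
    rw [Polynomial.aroots, Polynomial.mem_roots', Polynomial.IsRoot.def, Polynomial.eval_map]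
    refine ⟨Polynomial.map_ne_zero (minpoly.ne_zero (Algebra.IsIntegral.isIntegral θ)), ?_⟩
    rw [hmin, Polynomial.eval₂_map]
    have h1 : (algebraMap FA FC).comp (algebraMap A FA) = (algebraMap C FC).comp ι :=
      RingHom.ext hlift
    rw [h1, ← Polynomial.hom_eval₂]
    change algebraMap C FC (P.eval₂ (shiftMap L a).toRingHom t) = 0
    rw [ht, map_zero]
  let φ0 : IntermediateField.adjoin FA {θ} →ₐ[FA] FC :=
    (IntermediateField.algHomAdjoinIntegralEquiv FA (Algebra.IsIntegral.isIntegral θ)).symm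
      ⟨_, hroot⟩
  let φ : K →ₐ[FA] FC := φ0.comp
    (((IntermediateField.equivOfEq htop).trans IntermediateField.topEquiv).symm : K →ₐ[FA] _)
  have hφA : ∀ r : A, φ (algebraMap R K (algebraMap A R r)) = algebraMap C FC (ι r) := by
    intro r
    rw [← IsScalarTower.algebraMap_apply A R K, IsScalarTower.algebraMap_apply A FA K,
      AlgHom.commutes, hlift]
  have hφinj : Function.Injective φ := φ.toRingHom.injective
  obtain ⟨b, hb⟩ := Module.Finite.fg_top (R := A) (M := R)
  classical
  obtain ⟨h, hh⟩ := IsLocalization.exist_integer_multiples_of_finset (nonZeroDivisors C)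
    (b.image fun x => φ (algebraMap R K x))
  have hex : ∀ x : R, ∃ c : C, algebraMap C FC c = algebraMap C FC h * φ (algebraMap R K x) := by
    intro x
    have hx : x ∈ Submodule.span A (b : Set R) := by rw [hb]; trivial
    induction hx using Submodule.span_induction with
    | mem x hx =>
      obtain ⟨c, hc⟩ := hh _ (Finset.mem_image_of_mem _ hx)
      exact ⟨c, by rw [hc, Algebra.smul_def]⟩
    | zero => exact ⟨0, by simp⟩
    | add x y _ _ h1 h2 =>
      obtain ⟨c, hc⟩ := h1
      obtain ⟨d, hd⟩ := h2
      exact ⟨c + d, by rw [map_add, hc, hd, map_add, map_add, mul_add]⟩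
    | smul r x _ h1 =>
      obtain ⟨c, hc⟩ := h1
      refine ⟨ι r * c, ?_⟩
      rw [map_mul, hc, Algebra.smul_def, map_mul, map_mul, hφA]
      ring
  choose ψ hψ using hex
  have hCinj : Function.Injective (algebraMap C FC) := IsFractionRing.injective C FC
  have hh0 : (h : C) ≠ 0 := nonZeroDivisors.ne_zero h.2
  have hh1 : algebraMap C FC h ≠ 0 := by rwa [Ne, map_eq_zero_iff _ hCinj]
  refine ⟨L, inferInstance, inferInstance, hfd, a, ψ, h, hh0, ?_, ?_, ?_, ?_⟩
  · intro x y hxy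
    have h1 := congrArg (algebraMap C FC) hxy
    rw [hψ, hψ] at h1
    exact IsFractionRing.injective R K (hφinj (mul_left_cancel₀ hh1 h1))
  · intro x y
    apply hCinj
    rw [map_add (algebraMap C FC), hψ, hψ, hψ, map_add, map_add, mul_add]
  · intro x y
    apply hCinj
    rw [map_mul (algebraMap C FC), map_mul (algebraMap C FC), hψ, hψ, hψ, map_mul, map_mul]
    ring
  · intro r x
    apply hCinj
    rw [map_mul (algebraMap C FC), hψ, hψ, map_mul, map_mul, hφA]
    change _ = algebraMap C FC (ι r) * _
    ring

theorem mem_restrictDegree_iff_degreeOf {k : Type} [Field k] {s n : ℕ}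
    (p : MvPolynomial (Fin s) k) :
    p ∈ MvPolynomial.restrictDegree (Fin s) k n ↔ ∀ i, p.degreeOf i ≤ n := by
  rw [MvPolynomial.mem_restrictDegree]
  constructor
  · intro h i
    rw [MvPolynomial.degreeOf_le_iff]
    exact fun m hm => h m hm i
  · intro h m hm i
    exact (MvPolynomial.degreeOf_le_iff.1 (h i)) m hm

theorem restrictDegree_le_span {k : Type} [Field k] {s n : ℕ} :
    ∃ T : Finset (MvPolynomial (Fin s) k), T.card ≤ (n + 1) ^ s ∧
      MvPolynomial.restrictDegree (Fin s) k n ≤ Submodule.span k (T : Set _) := by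
  classical
  refine ⟨Finset.univ.image fun w : Fin s → Fin (n + 1) =>
    MvPolynomial.monomial (Finsupp.equivFunOnFinite.symm fun i => (w i : ℕ)) (1 : k), ?_, ?_⟩
  · refine Finset.card_image_le.trans ?_
    simp
  · intro p hp
    rw [MvPolynomial.mem_restrictDegree] at hp
    rw [p.as_sum]
    refine Submodule.sum_mem _ fun m hm => ?_
    have : MvPolynomial.monomial m (p.coeff m) = p.coeff m • MvPolynomial.monomial m (1 : k) := by
      simp [MvPolynomial.smul_monomial]
    rw [this]
    refine Submodule.smul_mem _ _ (Submodule.subset_span ?_)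
    rw [Finset.coe_image]
    refine ⟨fun i => ⟨m i, Nat.lt_succ_of_le (hp m hm i)⟩, by simp, ?_⟩
    dsimp only
    congr 2
    ext i
    simp

theorem finite_restrictDegree {k : Type} [Field k] {s n : ℕ} :
    FiniteDimensional k (MvPolynomial.restrictDegree (Fin s) k n) ∧
    Module.finrank k (MvPolynomial.restrictDegree (Fin s) k n) ≤ (n + 1) ^ s := by
  obtain ⟨T, hT, hle⟩ := restrictDegree_le_span (k := k) (s := s) (n := n)
  have : FiniteDimensional k (Submodule.span k (T : Set (MvPolynomial (Fin s) k))) :=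
    FiniteDimensional.span_finset k T
  exact ⟨Submodule.finiteDimensional_of_le hle,
    (Submodule.finrank_mono hle).trans ((finrank_span_finset_le_card T).trans hT)⟩

theorem growth_bound {k R : Type} [Field k] [CommRing R] [Algebra k R] {s : ℕ}
    (g : MvPolynomial (Fin s) k →ₐ[k] R) (b : Finset R)
    (hb : ∀ x : R, ∃ c : b → MvPolynomial (Fin s) k, x = ∑ j, g (c j) * j)
    (E : Submodule k R) (hE : E.FG) :
    ∃ C : ℝ, ∀ n : ℕ, 1 ≤ n →
      FiniteDimensional k (E ^ n : Submodule k R) ∧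
      (Module.finrank k (E ^ n : Submodule k R) : ℝ) ≤ C * (n : ℝ) ^ s := by
  classical
  let T : ℕ → Submodule k (MvPolynomial (Fin s) k) := MvPolynomial.restrictDegree (Fin s) k
  have hT : ∀ n p, p ∈ T n ↔ ∀ i, p.degreeOf i ≤ n := fun n p =>
    mem_restrictDegree_iff_degreeOf p
  have hTfd : ∀ n, FiniteDimensional k (T n) := fun n => finite_restrictDegree.1
  let Φ : (b → MvPolynomial (Fin s) k) →ₗ[k] R :=
    ∑ j : b, (LinearMap.mulRight k (j : R)).comp (g.toLinearMap.comp (LinearMap.proj j))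
  have hΦ : ∀ c, Φ c = ∑ j : b, g (c j) * j := by
    intro c; simp [Φ]
  let Q : ℕ → Submodule k R := fun n => LinearMap.range (Φ.comp
    (LinearMap.pi fun j : b => (T n).subtype.comp (LinearMap.proj j)))
  have hQ : ∀ n x, x ∈ Q n ↔ ∃ c : b → MvPolynomial (Fin s) k, (∀ j, c j ∈ T n) ∧
      x = ∑ j, g (c j) * j := by
    intro n x
    constructor
    · rintro ⟨c, rfl⟩
      refine ⟨fun j => c j, fun j => (c j).2, ?_⟩
      rw [LinearMap.comp_apply, hΦ]
      rfl
    · rintro ⟨c, hc, rfl⟩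
      refine ⟨fun j => ⟨c j, hc j⟩, ?_⟩
      rw [LinearMap.comp_apply, hΦ]
      rfl
  have hQfd : ∀ n, FiniteDimensional k (Q n) := fun n => inferInstance
  have hQr : ∀ n, Module.finrank k (Q n) ≤ b.card * (n + 1) ^ s := by
    intro n
    refine (LinearMap.finrank_range_le _).trans ?_
    rw [Module.finrank_pi_fintype]
    simp only [Finset.sum_const, smul_eq_mul, Finset.card_univ, Fintype.card_coe]
    exact Nat.mul_le_mul_left _ finite_restrictDegree.2
  have hcov : ∀ x, ∃ D, x ∈ Q D := by
    intro x
    obtain ⟨c, hc⟩ := hb x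
    refine ⟨∑ j, ∑ i, (c j).degreeOf i, (hQ _ _).2 ⟨c, fun j => (hT _ _).2 fun i => ?_, hc⟩⟩
    exact (Finset.single_le_sum (f := fun i => (c j).degreeOf i) (fun _ _ => Nat.zero_le _)
      (Finset.mem_univ i)).trans (Finset.single_le_sum (f := fun j => ∑ i, (c j).degreeOf i)
        (fun _ _ => Nat.zero_le _) (Finset.mem_univ j))
  have hQmono : Monotone Q := by
    intro m n hmn x hx
    obtain ⟨c, hc, rfl⟩ := (hQ _ _).1 hx
    exact (hQ _ _).2 ⟨c, fun j => (hT _ _).2 fun i => ((hT _ _).1 (hc j) i).trans hmn, rfl⟩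
  choose D hD using hcov
  obtain ⟨e, rfl⟩ := hE
  let D0 := D 1 + ∑ x ∈ e, ∑ j ∈ b, D (x * j)
  have hD0 : ∀ x ∈ e, ∀ j ∈ b, x * j ∈ Q D0 := by
    intro x hx j hj
    refine hQmono ?_ (hD (x * j))
    have h1 : D (x * j) ≤ ∑ j ∈ b, D (x * j) :=
      Finset.single_le_sum (f := fun j => D (x * j)) (fun _ _ => Nat.zero_le _) hj
    have h2 : ∑ j ∈ b, D (x * j) ≤ ∑ x ∈ e, ∑ j ∈ b, D (x * j) :=
      Finset.single_le_sum (f := fun x => ∑ j ∈ b, D (x * j)) (fun _ _ => Nat.zero_le _) hx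
    omega
  have hstep : ∀ n, Submodule.span k (e : Set R) * Q n ≤ Q (n + D0) := by
    intro n
    rw [Submodule.mul_le]
    intro x hx y hy
    obtain ⟨c, hc, rfl⟩ := (hQ _ _).1 hy
    induction hx using Submodule.span_induction with
    | zero => simp
    | add x x' _ _ h1 h2 => rw [add_mul]; exact add_mem h1 h2
    | smul r x _ h1 => rw [smul_mul_assoc]; exact Submodule.smul_mem _ _ h1
    | mem x hx =>
      rw [Finset.mul_sum]
      refine Submodule.sum_mem _ fun j _ => ?_
      obtain ⟨c', hc', h'⟩ := (hQ _ _).1 (hD0 x hx j j.2)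
      refine (hQ _ _).2 ⟨fun l => c j * c' l, fun l => (hT _ _).2 fun i => ?_, ?_⟩
      · exact (MvPolynomial.degreeOf_mul_le i _ _).trans
          (add_le_add ((hT _ _).1 (hc j) i) ((hT _ _).1 (hc' l) i))
      · rw [mul_left_comm, h', Finset.mul_sum]
        refine Finset.sum_congr rfl fun l _ => ?_
        rw [map_mul, mul_assoc]
  have hpow : ∀ n, (Submodule.span k (e : Set R)) ^ n ≤ Q (D0 * (n + 1)) := by
    intro n
    induction n with
    | zero =>
      rw [pow_zero, Submodule.one_le]
      exact hQmono (by simp [D0]) (hD 1)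
    | succ n ih =>
      rw [pow_succ']
      refine (mul_le_mul_right ih _).trans ((hstep _).trans (le_of_eq ?_))
      congr 1
  refine ⟨b.card * (2 * D0 + 1) ^ s, fun n hn => ⟨Submodule.finiteDimensional_of_le (hpow n), ?_⟩⟩
  have h1 : Module.finrank k ((Submodule.span k (e : Set R)) ^ n : Submodule k R) ≤
      b.card * ((2 * D0 + 1) * n) ^ s := by
    refine (Submodule.finrank_mono (hpow n)).trans ((hQr _).trans ?_)
    refine Nat.mul_le_mul_left _ (Nat.pow_le_pow_left ?_ _)
    nlinarith
  calc (Module.finrank k ((Submodule.span k (e : Set R)) ^ n : Submodule k R) : ℝ)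
      ≤ ((b.card * ((2 * D0 + 1) * n) ^ s : ℕ) : ℝ) := by exact_mod_cast h1
    _ = _ := by push_cast; rw [mul_pow]; ring

theorem family_limit {k R : Type} [Field k] [CharZero k] [CommRing R] [IsDomain R] [Algebra k R]
    (hFG : Algebra.FiniteType k R) :
    ∃ s : ℕ, ((s : ℕ∞) : WithBot ℕ∞) ≤ ringKrullDim R ∧ ∃ ζ : Fin s → R,
      ∀ (V : ℕ → Submodule k R) (E : Submodule k R) (_ : E.FG) (_ : ∀ n, 1 ≤ n → V n ≤ E ^ n)
        (_ : ∀ m n, 1 ≤ m → 1 ≤ n → ∀ x ∈ V m, ∀ y ∈ V n, x * y ∈ V (m + n))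
        (f : R) (_ : f ≠ 0)
        (_ : ∀ n, 1 ≤ n → ∀ w : Fin s →₀ ℕ, (∑ i, w i) ≤ n → f ^ n * ∏ i, ζ i ^ w i ∈ V n),
        ∃ l : ℝ, Tendsto (fun n : ℕ => (Module.finrank k (V n) : ℝ) / (n : ℝ) ^ s) atTop (nhds l) ∧
          ∀ n, 1 ≤ n → FiniteDimensional k (V n) := by
  obtain ⟨s, g, hginj, hgfin⟩ := exists_finite_inj_algHom_of_fg k R
  let _ : Algebra (MvPolynomial (Fin s) k) R := g.toRingHom.toAlgebra
  have hgalg : ∀ r, algebraMap (MvPolynomial (Fin s) k) R r = g r := fun _ => rfl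
  have hfin : Module.Finite (MvPolynomial (Fin s) k) R := hgfin
  have hinj : Function.Injective (algebraMap (MvPolynomial (Fin s) k) R) := hginj
  have hdim := dim_le_of_noether (k := k) (R := R) (s := s) hinj
  obtain ⟨L, _, _, hfd, a, ψ, h, hh, hψinj, hψadd, hψmul, hψA⟩ :=
    exists_embedding (k := k) (R := R) (s := s) hinj
  refine ⟨s, hdim, fun i => g (MvPolynomial.X i - MvPolynomial.C (a i)), ?_⟩
  intro V E hE hVE hVmul f hf hfV
  obtain ⟨b, hb⟩ := Module.Finite.fg_top (R := MvPolynomial (Fin s) k) (M := R)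
  have hb' : ∀ x : R, ∃ c : b → MvPolynomial (Fin s) k, x = ∑ j, g (c j) * j := by
    intro x
    have hx : x ∈ Submodule.span (MvPolynomial (Fin s) k) (b : Set R) := by rw [hb]; trivial
    obtain ⟨c, -, hc⟩ := Submodule.mem_span_finset.1 hx
    refine ⟨fun j => c j, ?_⟩
    rw [← hc, ← Finset.sum_coe_sort]
    rfl
  obtain ⟨B, hB⟩ := growth_bound g b hb' E hE
  have hVfd : ∀ n, 1 ≤ n → FiniteDimensional k (V n) := fun n hn =>
    haveI := (hB n hn).1
    Submodule.finiteDimensional_of_le (hVE n hn)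
  have hψsmul : ∀ (c : k) x, ψ (c • x) = c • ψ x := by
    intro c x
    have h1 : c • x = algebraMap (MvPolynomial (Fin s) k) R (algebraMap k _ c) * x := by
      rw [hgalg, AlgHom.commutes, Algebra.smul_def]
    rw [h1, hψA, AlgHom.commutes, ← Algebra.smul_def]
  let ψl : R →ₗ[k] MvPowerSeries (Fin s) L :=
    { toFun := ψ, map_add' := hψadd, map_smul' := hψsmul }
  let Ψ : ℕ → R →ₗ[k] MvPowerSeries (Fin s) L := fun n => (LinearMap.mulLeft k (h ^ (n - 1))).comp ψl
  have hΨ : ∀ n x, Ψ n x = h ^ (n - 1) * ψ x := fun n x => rfl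
  have hΨinj : ∀ n, Function.Injective (Ψ n) := by
    intro n x y hxy
    rw [hΨ, hΨ] at hxy
    exact hψinj (mul_left_cancel₀ (pow_ne_zero _ hh) hxy)
  have hfr : ∀ n, Module.finrank k ((V n).map (Ψ n)) = Module.finrank k (V n) := fun n =>
    ((Submodule.equivMapOfInjective (Ψ n) (hΨinj n) (V n)).finrank_eq).symm
  have hFpow : ∀ n, 1 ≤ n → h ^ (n - 1) * ψ (f ^ n) = ψ f ^ n := by
    intro n hn
    induction n, hn using Nat.le_induction with
    | base => simp
    | succ n hn ih =>
      have h2 : h ^ (n + 1 - 1) = h ^ (n - 1) * h := by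
        rw [← pow_succ]; congr 1; omega
      rw [h2, pow_succ, pow_succ, mul_assoc, hψmul, ← mul_assoc, ih]
  have hmon : ∀ (w : Fin s →₀ ℕ) x,
      ψ (x * ∏ i, g (MvPolynomial.X i - MvPolynomial.C (a i)) ^ w i) =
        ψ x * MvPowerSeries.monomial w 1 := by
    intro w x
    have h1 : x * ∏ i, g (MvPolynomial.X i - MvPolynomial.C (a i)) ^ w i =
        algebraMap (MvPolynomial (Fin s) k) R
          (∏ i, (MvPolynomial.X i - MvPolynomial.C (a i)) ^ w i) * x := by
      rw [hgalg, map_prod, mul_comm]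
      simp only [map_pow]
    rw [h1, hψA, mul_comm, map_prod]
    congr 1
    have h2 : ∀ i, shiftMap L a (MvPolynomial.X i - MvPolynomial.C (a i)) = MvPowerSeries.X i := by
      intro i
      have : (MvPolynomial.C (a i) : MvPolynomial (Fin s) k) = algebraMap k _ (a i) := rfl
      rw [map_sub, this, AlgHom.commutes, shiftMap_X, add_sub_cancel_left]
    simp only [map_pow, h2]
    have h3 := congrArg (fun p : MvPolynomial (Fin s) L => (p : MvPowerSeries (Fin s) L))
      (MvPolynomial.monomial_eq (s := w) (a := (1 : L)))
    simp only [MvPolynomial.coe_monomial] at h3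
    rw [h3, Finsupp.prod_fintype _ _ (by simp)]
    rw [← MvPolynomial.coeToMvPowerSeries.ringHom_apply, map_mul, map_prod]
    simp
  obtain ⟨l, hl⟩ := series_limit (fun n => (V n).map (Ψ n))
    (fun n hn => by
      have := hVfd n hn
      infer_instance)
    (by
      rintro m n hm hn _ ⟨x, hx, rfl⟩ _ ⟨y, hy, rfl⟩
      refine ⟨x * y, hVmul m n hm hn x hx y hy, ?_⟩
      rw [hΨ, hΨ, hΨ]
      have h2 : h ^ (m + n - 1) = h ^ (m - 1) * h ^ (n - 1) * h := by
        rw [← pow_add, ← pow_succ]; congr 1; omega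
      rw [h2, mul_assoc, hψmul]
      ring)
    (ψ f)
    (by
      intro h0
      have : ψ 0 = 0 := ψl.map_zero
      exact hf (hψinj (h0.trans this.symm)))
    (by
      intro n hn w hw
      refine ⟨_, hfV n hn w hw, ?_⟩
      rw [hΨ, hmon, ← mul_assoc, hFpow n hn])
    B
    (by
      intro n hn
      rw [hfr]
      have := (hB n hn).1
      exact le_trans (by exact_mod_cast Submodule.finrank_mono (hVE n hn)) (hB n hn).2)
  refine ⟨l, ?_, hVfd⟩
  simpa only [hfr] using hl

section Graded

variable {k R : Type} [Field k] [CommRing R] [Algebra k R] (𝒜 : ℕ → Submodule k R)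
  [GradedAlgebra 𝒜]

/-- The degree `j` component, as a linear map. -/
noncomputable def hcomp (j : ℕ) : R →ₗ[k] R := GradedAlgebra.proj 𝒜 j

theorem hcomp_eq (j : ℕ) (x : R) : hcomp 𝒜 j x = (DirectSum.decompose 𝒜 x j : R) := rfl

theorem hcomp_mem (j : ℕ) (x : R) : hcomp 𝒜 j x ∈ 𝒜 j := by
  rw [hcomp_eq]; exact SetLike.coe_mem _

theorem hcomp_same {j : ℕ} {x : R} (hx : x ∈ 𝒜 j) : hcomp 𝒜 j x = x := by
  rw [hcomp_eq]; exact DirectSum.decompose_of_mem_same 𝒜 hx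

theorem hcomp_ne {i j : ℕ} {x : R} (hx : x ∈ 𝒜 i) (hij : i ≠ j) : hcomp 𝒜 j x = 0 := by
  rw [hcomp_eq]; exact DirectSum.decompose_of_mem_ne 𝒜 hx hij

theorem hcomp_mul (j : ℕ) (x y : R) :
    hcomp 𝒜 j (x * y) = ∑ ij ∈ Finset.HasAntidiagonal.antidiagonal j, hcomp 𝒜 ij.1 x * hcomp 𝒜 ij.2 y := by
  simp only [hcomp_eq]
  rw [DirectSum.decompose_mul, DirectSum.coe_mul_apply_eq_sum_antidiagonal]

theorem hcomp_bound (x : R) : ∃ D : ℕ, ∀ e, D < e → hcomp 𝒜 e x = 0 := by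
  classical
  refine ⟨(DirectSum.decompose 𝒜 x).support.sup id, fun e he => ?_⟩
  by_contra h
  have : e ∈ (DirectSum.decompose 𝒜 x).support := by
    rw [DFinsupp.mem_support_iff]
    intro h2
    exact h (by rw [hcomp_eq, h2]; rfl)
  exact absurd he (not_lt.2 (Finset.le_sup (f := id) this))

theorem hcomp_sum {x : R} {D : ℕ} (hD : ∀ e, D < e → hcomp 𝒜 e x = 0) :
    x = ∑ e ∈ Finset.range (D + 1), hcomp 𝒜 e x := by
  classical
  conv_lhs => rw [← DirectSum.sum_support_decompose 𝒜 x]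
  refine Finset.sum_subset ?_ ?_
  · intro e he
    rw [DFinsupp.mem_support_iff] at he
    rw [Finset.mem_range]
    by_contra h
    apply he
    have := hD e (by omega)
    rw [hcomp_eq] at this
    exact Subtype.ext this
  · intro e _ he
    rw [DFinsupp.notMem_support_iff] at he
    rw [he]; rfl

theorem mem_of_hcomp_mem {S : Type} [SetLike S R] [AddSubmonoidClass S R] {J : S} {x : R}
    (h : ∀ e, hcomp 𝒜 e x ∈ J) : x ∈ J := by
  obtain ⟨D, hD⟩ := hcomp_bound 𝒜 x
  rw [hcomp_sum 𝒜 hD]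
  exact sum_mem fun e _ => h e

theorem homog_pow {I : Ideal R} (hI : I.IsHomogeneous 𝒜) (n : ℕ) : (I ^ n).IsHomogeneous 𝒜 := by
  induction n with
  | zero => rw [pow_zero, Ideal.one_eq_top]; exact Ideal.IsHomogeneous.top 𝒜
  | succ n ih => rw [pow_succ]; exact ih.mul hI

theorem homog_hcomp {I : Ideal R} (hI : I.IsHomogeneous 𝒜) {x : R} (hx : x ∈ I) (e : ℕ) :
    hcomp 𝒜 e x ∈ I := hI e hx

theorem homog_colon {J P : Ideal R} (hJ : J.IsHomogeneous 𝒜) (hP : P.IsHomogeneous 𝒜) {y : R}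
    (h : ∀ x ∈ P, x * y ∈ J) (b : ℕ) : ∀ x ∈ P, x * hcomp 𝒜 b y ∈ J := by
  intro x hx
  obtain ⟨D, hD⟩ := hcomp_bound 𝒜 x
  rw [hcomp_sum 𝒜 hD, Finset.sum_mul]
  refine Ideal.sum_mem _ fun e _ => ?_
  have h1 : hcomp 𝒜 (e + b) (hcomp 𝒜 e x * y) = hcomp 𝒜 e x * hcomp 𝒜 b y := by
    simp only [hcomp_eq]
    exact DirectSum.coe_decompose_mul_add_of_left_mem 𝒜 (hcomp_mem 𝒜 e x)
  rw [← h1]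
  exact homog_hcomp 𝒜 hJ (h _ (homog_hcomp 𝒜 hP hx e)) _

theorem hcomp_mem_pow (T : Set R) (hT : T ⊆ 𝒜 1) (hgen : Algebra.adjoin k T = ⊤) (x : R) (e : ℕ) :
    hcomp 𝒜 e x ∈ (Submodule.span k T) ^ e := by
  have hx : x ∈ Algebra.adjoin k T := by rw [hgen]; trivial
  induction hx using Algebra.adjoin_induction generalizing e with
  | mem x hx =>
    by_cases he : e = 1
    · subst he
      rw [hcomp_same 𝒜 (hT hx), pow_one]
      exact Submodule.subset_span hx
    · rw [hcomp_ne 𝒜 (hT hx) (Ne.symm he)]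
      exact zero_mem _
  | algebraMap r =>
    have h0 : algebraMap k R r ∈ 𝒜 0 := SetLike.algebraMap_mem_graded 𝒜 r
    by_cases he : e = 0
    · subst he
      rw [hcomp_same 𝒜 h0, pow_zero]
      exact Submodule.mem_one.2 ⟨r, rfl⟩
    · rw [hcomp_ne 𝒜 h0 (Ne.symm he)]
      exact zero_mem _
  | add x y _ _ h1 h2 => rw [map_add]; exact add_mem (h1 e) (h2 e)
  | mul x y _ _ h1 h2 =>
    rw [hcomp_mul]
    refine Submodule.sum_mem _ fun ij hij => ?_
    rw [← Finset.HasAntidiagonal.mem_antidiagonal.1 hij, pow_add]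
    exact Submodule.mul_mem_mul (h1 _) (h2 _)

theorem exists_finset_gen (hFG : Algebra.FiniteType k R)
    (hstd : Algebra.adjoin k (𝒜 1 : Set R) = ⊤) :
    ∃ T : Finset R, (T : Set R) ⊆ 𝒜 1 ∧ Algebra.adjoin k (T : Set R) = ⊤ := by
  classical
  obtain ⟨S, hS⟩ := hFG.out
  have hex : ∀ x : R, ∃ T : Finset R, (T : Set R) ⊆ 𝒜 1 ∧ x ∈ Algebra.adjoin k (T : Set R) := by
    intro x
    have hx : x ∈ Algebra.adjoin k (𝒜 1 : Set R) := by rw [hstd]; trivial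
    induction hx using Algebra.adjoin_induction with
    | mem x hx => exact ⟨{x}, by simpa using hx, Algebra.subset_adjoin (by simp)⟩
    | algebraMap r => exact ⟨∅, by simp, Subalgebra.algebraMap_mem _ r⟩
    | add x y _ _ h1 h2 =>
      obtain ⟨T1, hT1, h1⟩ := h1
      obtain ⟨T2, hT2, h2⟩ := h2
      refine ⟨T1 ∪ T2, by simp [hT1, hT2], add_mem ?_ ?_⟩
      · exact Algebra.adjoin_mono (by simp) h1
      · exact Algebra.adjoin_mono (by simp) h2
    | mul x y _ _ h1 h2 =>
      obtain ⟨T1, hT1, h1⟩ := h1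
      obtain ⟨T2, hT2, h2⟩ := h2
      refine ⟨T1 ∪ T2, by simp [hT1, hT2], mul_mem ?_ ?_⟩
      · exact Algebra.adjoin_mono (by simp) h1
      · exact Algebra.adjoin_mono (by simp) h2
  choose T hT hTx using hex
  refine ⟨S.biUnion T, ?_, ?_⟩
  · intro y hy
    simp only [Finset.coe_biUnion, Set.mem_iUnion] at hy
    obtain ⟨x, _, hy⟩ := hy
    exact hT x hy
  · rw [eq_top_iff, ← hS, Algebra.adjoin_le_iff]
    intro x hx
    refine Algebra.adjoin_mono ?_ (hTx x)
    exact Finset.coe_subset.2 (Finset.subset_biUnion_of_mem T hx)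

theorem hcomp_mem_ideal_pow {m : Ideal R} (hm : ∀ x ∈ 𝒜 1, x ∈ m)
    (hstd : Algebra.adjoin k (𝒜 1 : Set R) = ⊤) (x : R) (e : ℕ) : hcomp 𝒜 e x ∈ m ^ e := by
  have h1 := hcomp_mem_pow 𝒜 (𝒜 1 : Set R) le_rfl hstd x e
  have h2 : ∀ e, (Submodule.span k (𝒜 1 : Set R)) ^ e ≤ (m ^ e).restrictScalars k := by
    intro e
    induction e with
    | zero => intro y _; simp
    | succ e ih =>
      rw [pow_succ, Submodule.mul_le]
      intro a ha b hb
      rw [Submodule.span_eq] at hb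
      rw [Submodule.restrictScalars_mem, pow_succ]
      exact Ideal.mul_mem_mul (ih ha) (hm b hb)
  exact h2 e h1

/-- The `m`-saturation of an ideal. -/
def satI (m J : Ideal R) : Ideal R where
  carrier := {y | ∃ N : ℕ, ∀ x ∈ m ^ N, x * y ∈ J}
  zero_mem' := ⟨0, fun x _ => by simp⟩
  add_mem' := by
    rintro a b ⟨N, hN⟩ ⟨M, hM⟩
    refine ⟨N + M, fun x hx => ?_⟩
    rw [mul_add]
    exact add_mem (hN x (Ideal.pow_le_pow_right (by omega) hx))
      (hM x (Ideal.pow_le_pow_right (by omega) hx))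
  smul_mem' := by
    rintro c a ⟨N, hN⟩
    refine ⟨N, fun x hx => ?_⟩
    rw [smul_eq_mul, mul_left_comm]
    exact Ideal.mul_mem_left _ _ (hN x hx)


theorem mem_satI {m J : Ideal R} {y : R} : y ∈ satI m J ↔ ∃ N : ℕ, ∀ x ∈ m ^ N, x * y ∈ J :=
  Iff.rfl

theorem satI_mono {m J J' : Ideal R} (h : J ≤ J') : satI m J ≤ satI m J' := by
  rintro y ⟨N, hN⟩
  exact ⟨N, fun x hx => h (hN x hx)⟩

theorem mul_mem_satI {m J J' : Ideal R} {x y : R} (hx : x ∈ J) (hy : y ∈ satI m J') :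
    x * y ∈ satI m (J * J') := by
  obtain ⟨N, hN⟩ := hy
  refine ⟨N, fun z hz => ?_⟩
  rw [mul_left_comm]
  exact Ideal.mul_mem_mul hx (hN z hz)

theorem satI_mul_satI {m J J' : Ideal R} {x y : R} (hx : x ∈ satI m J) (hy : y ∈ satI m J') :
    x * y ∈ satI m (J * J') := by
  obtain ⟨N, hN⟩ := hx
  obtain ⟨M, hM⟩ := hy
  refine ⟨N + M, fun z hz => ?_⟩
  rw [pow_add] at hz
  induction hz using Submodule.mul_induction_on' with
  | mem_mul_mem a ha b hb =>
    have : a * b * (x * y) = (a * x) * (b * y) := by ring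
    rw [this]
    exact Ideal.mul_mem_mul (hN a ha) (hM b hb)
  | add a _ b _ h1 h2 => rw [add_mul]; exact add_mem h1 h2

theorem le_satI (m J : Ideal R) : J ≤ satI m J := fun _ hy =>
  ⟨0, fun _ _ => Ideal.mul_mem_left _ _ hy⟩

theorem exists_gen_degree [IsNoetherianRing R] {I : Ideal R} (hI : I.IsHomogeneous 𝒜) :
    ∃ δ : ℕ, ∀ a : ℕ, I ^ a ≤ Ideal.span {t | t ∈ I ^ a ∧ ∃ e ≤ δ * a, t ∈ 𝒜 e} := by
  obtain ⟨S, hS⟩ := (isNoetherianRing_iff_ideal_fg R).1 inferInstance I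
  choose D hD using hcomp_bound 𝒜
  refine ⟨∑ x ∈ S, D x, fun a => ?_⟩
  have h1 : I ≤ Ideal.span {t | t ∈ I ∧ ∃ e ≤ ∑ x ∈ S, D x, t ∈ 𝒜 e} := by
    conv_lhs => rw [← hS]
    refine Ideal.span_le.2 fun x hx => ?_
    have hxI : x ∈ I := by rw [← hS]; exact Ideal.subset_span hx
    change x ∈ Ideal.span _
    rw [hcomp_sum 𝒜 (hD x)]
    refine Ideal.sum_mem _ fun e he => Ideal.subset_span ⟨homog_hcomp 𝒜 hI hxI e, e, ?_,
      hcomp_mem 𝒜 e x⟩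
    have := Finset.single_le_sum (f := D) (fun _ _ => Nat.zero_le _) hx
    have := Finset.mem_range.1 he
    omega
  induction a with
  | zero =>
    intro x _
    have : (1 : R) ∈ Ideal.span {t | t ∈ I ^ 0 ∧ ∃ e ≤ (∑ x ∈ S, D x) * 0, t ∈ 𝒜 e} :=
      Ideal.subset_span ⟨by simp, 0, by simp, SetLike.one_mem_graded 𝒜⟩
    rw [(Ideal.eq_top_iff_one _).2 this]
    trivial
  | succ a ih =>
    rw [pow_succ]
    refine (Ideal.mul_mono ih h1).trans ?_
    rw [Ideal.span_mul_span']
    refine Ideal.span_mono ?_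
    rintro _ ⟨t, ⟨ht, e, he, hte⟩, u, ⟨hu, e', he', hue⟩, rfl⟩
    refine ⟨Ideal.mul_mem_mul ht hu, e + e', ?_, SetLike.mul_mem_graded hte hue⟩
    rw [mul_add, mul_one]; omega

theorem mem_pow_mul_of_degree {I m : Ideal R} (hm : ∀ x ∈ 𝒜 1, x ∈ m)
    (hstd : Algebra.adjoin k (𝒜 1 : Set R) = ⊤) {δ a N b : ℕ}
    (hδ : I ^ a ≤ Ideal.span {t | t ∈ I ^ a ∧ ∃ e ≤ δ * a, t ∈ 𝒜 e}) (hb : δ * a + N ≤ b)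
    {x : R} (hx : x ∈ I ^ a) : hcomp 𝒜 b x ∈ m ^ N * I ^ a := by
  have hx' := hδ hx
  clear hx
  induction hx' using Submodule.closure_induction with
  | zero => rw [map_zero]; exact zero_mem _
  | add x y _ _ h1 h2 => rw [map_add]; exact add_mem h1 h2
  | smul_mem r t ht =>
    obtain ⟨ht, e, he, hte⟩ := ht
    have hb' : b = (b - e) + e := by omega
    have h1 : hcomp 𝒜 b (r * t) = hcomp 𝒜 (b - e) r * t := by
      rw [hb', hcomp_eq, DirectSum.coe_decompose_mul_add_of_right_mem 𝒜 hte, hcomp_eq,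
        Nat.add_sub_cancel]
    rw [smul_eq_mul, h1]
    exact Ideal.mul_mem_mul (Ideal.pow_le_pow_right (by omega)
      (hcomp_mem_ideal_pow 𝒜 hm hstd r (b - e))) ht

theorem linear_bound [IsNoetherianRing R] {I m : Ideal R} (hI : I.IsHomogeneous 𝒜)
    (hmh : m.IsHomogeneous 𝒜) (hm : ∀ x ∈ 𝒜 1, x ∈ m)
    (hstd : Algebra.adjoin k (𝒜 1 : Set R) = ⊤) :
    ∃ c : ℕ, ∀ n, 1 ≤ n → ∀ j, c * n ≤ j → ∀ f ∈ 𝒜 j, f ∈ satI m (I ^ n) → f ∈ I ^ n := by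
  classical
  obtain ⟨δ, hδ⟩ := exists_gen_degree 𝒜 hI
  let Q : Ideal (reesAlgebra I) :=
    { carrier := {F | ∀ i, (F : Polynomial R).coeff i ∈ satI m (I ^ (i + 1))}
      zero_mem' := fun i => by simp
      add_mem' := by
        intro F G hF hG i
        rw [Subalgebra.coe_add, Polynomial.coeff_add]
        exact add_mem (hF i) (hG i)
      smul_mem' := by
        intro H F hF i
        rw [smul_eq_mul, Subalgebra.coe_mul, Polynomial.coeff_mul]
        refine Ideal.sum_mem _ fun ab hab => ?_
        have h1 : I ^ (i + 1) = I ^ ab.1 * I ^ (ab.2 + 1) := by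
          rw [← pow_add, ← Finset.HasAntidiagonal.mem_antidiagonal.1 hab]; rfl
        rw [h1]
        exact mul_mem_satI (H.2 _) (hF _) }
  have hQ : ∀ F : reesAlgebra I, F ∈ Q ↔
      ∀ i, (F : Polynomial R).coeff i ∈ satI m (I ^ (i + 1)) := fun F => Iff.rfl
  obtain ⟨G, hG⟩ := (isNoetherianRing_iff_ideal_fg (reesAlgebra I)).1 inferInstance Q
  have hGQ : ∀ F ∈ G, F ∈ Q := fun F hF => by rw [← hG]; exact Ideal.subset_span hF
  -- uniform exponent
  have hN1 : ∀ F : reesAlgebra I, ∃ N : ℕ, F ∈ Q → ∀ i, ∀ x ∈ m ^ N,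
      x * (F : Polynomial R).coeff i ∈ I ^ (i + 1) := by
    intro F
    by_cases hF : F ∈ Q
    · choose N hN using fun i => mem_satI.1 ((hQ F).1 hF i)
      refine ⟨∑ i ∈ Finset.range ((F : Polynomial R).natDegree + 1), N i, fun _ i x hx => ?_⟩
      by_cases hi : (F : Polynomial R).natDegree < i
      · rw [Polynomial.coeff_eq_zero_of_natDegree_lt hi, mul_zero]; exact zero_mem _
      · refine hN i x (Ideal.pow_le_pow_right ?_ hx)
        exact Finset.single_le_sum (f := N) (fun _ _ => Nat.zero_le _)
          (Finset.mem_range.2 (by omega))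
    · exact ⟨0, fun h => absurd h hF⟩
  choose N hN using hN1
  have hβ1 : ∀ F : reesAlgebra I, ∃ β : ℕ, ∀ i e, β < e →
      hcomp 𝒜 e ((F : Polynomial R).coeff i) = 0 := by
    intro F
    choose D hD using fun i => hcomp_bound 𝒜 ((F : Polynomial R).coeff i)
    refine ⟨∑ i ∈ Finset.range ((F : Polynomial R).natDegree + 1), D i, fun i e he => ?_⟩
    by_cases hi : (F : Polynomial R).natDegree < i
    · rw [Polynomial.coeff_eq_zero_of_natDegree_lt hi, map_zero]
    · refine hD i e (lt_of_le_of_lt ?_ he)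
      exact Finset.single_le_sum (f := D) (fun _ _ => Nat.zero_le _)
        (Finset.mem_range.2 (by omega))
  choose β hβ using hβ1
  set N0 := ∑ F ∈ G, N F
  set β0 := ∑ F ∈ G, β F
  have key : ∀ H ∈ Q, ∀ n j, δ * n + N0 + β0 ≤ j →
      hcomp 𝒜 j ((H : Polynomial R).coeff n) ∈ I ^ (n + 1) := by
    intro H hH
    rw [← hG] at hH
    induction hH using Submodule.closure_induction with
    | zero => intro n j _; simp
    | add x y _ _ h1 h2 =>
      intro n j hj
      rw [Subalgebra.coe_add, Polynomial.coeff_add, map_add]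
      exact add_mem (h1 n j hj) (h2 n j hj)
    | smul_mem r F hF =>
      intro n j hj
      rw [smul_eq_mul, Subalgebra.coe_mul, Polynomial.coeff_mul, map_sum]
      refine Ideal.sum_mem _ fun ab hab => ?_
      have hab' := Finset.HasAntidiagonal.mem_antidiagonal.1 hab
      rw [hcomp_mul]
      refine Ideal.sum_mem _ fun pe hpe => ?_
      have hpe' := Finset.HasAntidiagonal.mem_antidiagonal.1 hpe
      by_cases he : β F < pe.2
      · rw [hβ F _ _ he, mul_zero]; exact zero_mem _
      have hβF : β F ≤ β0 := Finset.single_le_sum (f := β) (fun _ _ => Nat.zero_le _) hF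
      have hNF : N F ≤ N0 := Finset.single_le_sum (f := N) (fun _ _ => Nat.zero_le _) hF
      have hδa : δ * ab.1 ≤ δ * n := Nat.mul_le_mul_left _ (by omega)
      have h1 : hcomp 𝒜 pe.1 ((r : Polynomial R).coeff ab.1) ∈ m ^ N F * I ^ ab.1 :=
        mem_pow_mul_of_degree 𝒜 hm hstd (hδ ab.1) (by omega) (r.2 _)
      have h2 : ∀ x ∈ m ^ N F, x * hcomp 𝒜 pe.2 ((F : Polynomial R).coeff ab.2) ∈ I ^ (ab.2 + 1) :=
        homog_colon 𝒜 (homog_pow 𝒜 hI _) (homog_pow 𝒜 hmh _) (hN F (hGQ F hF) ab.2) pe.2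
      have h3 : I ^ (n + 1) = I ^ ab.1 * I ^ (ab.2 + 1) := by
        rw [← pow_add, ← hab']; rfl
      rw [h3]
      generalize hcomp 𝒜 pe.1 ((r : Polynomial R).coeff ab.1) = z at h1 ⊢
      induction h1 using Submodule.mul_induction_on' with
      | mem_mul_mem x hx y hy =>
        rw [mul_comm x y, mul_assoc]
        exact Ideal.mul_mem_mul hy (h2 x hx)
      | add x _ y _ h1 h2 => rw [add_mul]; exact add_mem h1 h2
  refine ⟨δ + N0 + β0, fun n hn j hj f hf hfs => ?_⟩
  have hj' : δ * n + N0 + β0 ≤ j := by nlinarith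
  have hind : ∀ i, i ≤ n → f ∈ I ^ i := by
    intro i
    induction i with
    | zero => intro _; simp
    | succ i ih =>
      intro hi
      have hfi := ih (by omega)
      let H : reesAlgebra I := ⟨Polynomial.monomial i f, by
        rw [mem_reesAlgebra_iff]
        intro l
        rw [Polynomial.coeff_monomial]
        split_ifs with h
        · rw [← h]; exact hfi
        · exact zero_mem _⟩
      have hHQ : H ∈ Q := by
        rw [hQ]
        intro l
        change (Polynomial.monomial i f).coeff l ∈ _
        rw [Polynomial.coeff_monomial]
        split_ifs with h
        · rw [← h]; exact satI_mono (Ideal.pow_le_pow_right hi) hfs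
        · exact zero_mem _
      have hδi : δ * i ≤ δ * n := Nat.mul_le_mul_left _ (by omega)
      have h1 := key H hHQ i j (by omega)
      change hcomp 𝒜 j ((Polynomial.monomial i f).coeff i) ∈ _ at h1
      rwa [Polynomial.coeff_monomial, if_pos rfl, hcomp_same 𝒜 hf] at h1
  exact hind n le_rfl

/-- Elements all of whose components live in degrees at most `M`. -/
noncomputable def rlow (M : ℕ) : Submodule k R where
  carrier := {f | ∀ j, M < j → hcomp 𝒜 j f = 0}
  zero_mem' := fun j _ => map_zero _
  add_mem' := fun {a b} ha hb j hj => by rw [map_add, ha j hj, hb j hj, add_zero]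
  smul_mem' := fun c x hx j hj => by rw [map_smul, hx j hj, smul_zero]

theorem mem_rlow {M : ℕ} {f : R} : f ∈ rlow 𝒜 M ↔ ∀ j, M < j → hcomp 𝒜 j f = 0 := Iff.rfl

theorem rlow_mono {M M' : ℕ} (h : M ≤ M') : rlow 𝒜 M ≤ rlow 𝒜 M' :=
  fun _ hf j hj => hf j (lt_of_le_of_lt h hj)

theorem rlow_mul {M M' : ℕ} {x y : R} (hx : x ∈ rlow 𝒜 M) (hy : y ∈ rlow 𝒜 M') :
    x * y ∈ rlow 𝒜 (M + M') := by
  intro j hj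
  rw [hcomp_mul]
  refine Finset.sum_eq_zero fun ab hab => ?_
  have hab' := Finset.HasAntidiagonal.mem_antidiagonal.1 hab
  by_cases h : M < ab.1
  · rw [hx _ h, zero_mul]
  · rw [hy _ (by omega), mul_zero]

theorem rlow_one : (1 : R) ∈ rlow 𝒜 0 := fun j hj =>
  hcomp_ne 𝒜 (SetLike.one_mem_graded 𝒜) (by omega)

theorem rlow_pow {M : ℕ} {x : R} (hx : x ∈ rlow 𝒜 M) (n : ℕ) : x ^ n ∈ rlow 𝒜 (M * n) := by
  induction n with
  | zero => simpa using rlow_one 𝒜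
  | succ n ih => rw [pow_succ, mul_add, mul_one]; exact rlow_mul 𝒜 ih hx

theorem rlow_prod {ι : Type} (S : Finset ι) {M : ℕ} {x : ι → R} (hx : ∀ i, x i ∈ rlow 𝒜 M)
    (w : ι → ℕ) : ∏ i ∈ S, x i ^ w i ∈ rlow 𝒜 (M * ∑ i ∈ S, w i) := by
  classical
  induction S using Finset.induction_on with
  | empty => simpa using rlow_one 𝒜
  | insert a S ha ih =>
    rw [Finset.prod_insert ha, Finset.sum_insert ha, mul_add]
    exact rlow_mul 𝒜 (rlow_pow 𝒜 (hx a) _) ih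

theorem rlow_le_pow (T : Finset R) (hT : (T : Set R) ⊆ 𝒜 1)
    (hgen : Algebra.adjoin k (T : Set R) = ⊤) (M : ℕ) :
    rlow 𝒜 M ≤ (1 ⊔ Submodule.span k (T : Set R)) ^ M := by
  intro x hx
  rw [hcomp_sum 𝒜 hx]
  refine Submodule.sum_mem _ fun e he => ?_
  have h1 : (Submodule.span k (T : Set R)) ^ e ≤ (1 ⊔ Submodule.span k (T : Set R)) ^ e :=
    pow_le_pow_left' le_sup_right e
  have h2 : (1 ⊔ Submodule.span k (T : Set R)) ^ e ≤ (1 ⊔ Submodule.span k (T : Set R)) ^ M :=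
    pow_le_pow_right' le_sup_left (by have := Finset.mem_range.1 he; omega)
  exact h2 (h1 (hcomp_mem_pow 𝒜 _ hT hgen x e))

theorem hcomp_satI {J m : Ideal R} (hJ : J.IsHomogeneous 𝒜) (hm : m.IsHomogeneous 𝒜) {y : R}
    (hy : y ∈ satI m J) (e : ℕ) : hcomp 𝒜 e y ∈ satI m J := by
  obtain ⟨N, hN⟩ := hy
  exact ⟨N, homog_colon 𝒜 hJ (homog_pow 𝒜 hm N) hN e⟩

end Graded

theorem mk_mem_H0 {R : Type} [CommRing R] {m J : Ideal R} (y : R) :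
    (Ideal.Quotient.mk J y) ∈ H0 (M := R ⧸ J) m ↔ y ∈ satI m J := by
  unfold H0
  rw [Submodule.mem_iSup_of_directed]
  · refine exists_congr fun N => ?_
    rw [Submodule.mem_torsionBySet_iff]
    constructor
    · intro h x hx
      have := h ⟨x, hx⟩
      rw [← Ideal.Quotient.eq_zero_iff_mem, map_mul]
      exact this
    · rintro h ⟨x, hx⟩
      have := h x hx
      rw [← Ideal.Quotient.eq_zero_iff_mem, map_mul] at this
      exact this
  · refine Monotone.directed_le fun a b hab => ?_
    exact Submodule.torsionBySet_le_torsionBySet_of_subset (Ideal.pow_le_pow_right hab)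

theorem finrank_H0 {k R : Type} [Field k] [CommRing R] [Algebra k R] (𝒜 : ℕ → Submodule k R)
    [GradedAlgebra 𝒜] {J m : Ideal R} (hJ : J.IsHomogeneous 𝒜) (hm : m.IsHomogeneous 𝒜) (M : ℕ)
    (hM : ∀ j, M < j → ∀ f ∈ 𝒜 j, f ∈ satI m J → f ∈ J)
    [FiniteDimensional k ((satI m J).restrictScalars k ⊓ rlow 𝒜 M : Submodule k R)] :
    Module.finrank k (H0 (M := R ⧸ J) m) +
      Module.finrank k (J.restrictScalars k ⊓ rlow 𝒜 M : Submodule k R) =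
      Module.finrank k ((satI m J).restrictScalars k ⊓ rlow 𝒜 M : Submodule k R) := by
  set V : Submodule k R := (satI m J).restrictScalars k ⊓ rlow 𝒜 M with hV
  set W : Submodule k R := J.restrictScalars k ⊓ rlow 𝒜 M with hW
  let q : R →ₗ[k] R ⧸ J := (Ideal.Quotient.mkₐ k J).toLinearMap
  have hq : ∀ x, q x = Ideal.Quotient.mk J x := fun _ => rfl
  have hmap : V.map q = (H0 (M := R ⧸ J) m).restrictScalars k := by
    apply le_antisymm
    · rintro _ ⟨y, hy, rfl⟩
      rw [Submodule.restrictScalars_mem, hq, mk_mem_H0]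
      exact hy.1
    · intro x hx
      obtain ⟨y, rfl⟩ := Ideal.Quotient.mk_surjective x
      rw [Submodule.restrictScalars_mem, mk_mem_H0] at hx
      have hcc : ∀ j, hcomp 𝒜 j (∑ e ∈ Finset.range (M + 1), hcomp 𝒜 e y) =
          if j ≤ M then hcomp 𝒜 j y else 0 := by
        intro j
        rw [map_sum]
        split_ifs with h
        · rw [Finset.sum_eq_single j]
          · exact hcomp_same 𝒜 (hcomp_mem 𝒜 j y)
          · intro e _ he
            exact hcomp_ne 𝒜 (hcomp_mem 𝒜 e y) he
          · intro h2
            exact absurd (Finset.mem_range.2 (by omega)) h2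
        · refine Finset.sum_eq_zero fun e he => ?_
          have := Finset.mem_range.1 he
          exact hcomp_ne 𝒜 (hcomp_mem 𝒜 e y) (by omega)
      refine ⟨∑ e ∈ Finset.range (M + 1), hcomp 𝒜 e y, ⟨?_, ?_⟩, ?_⟩
      · exact Ideal.sum_mem _ fun e _ => hcomp_satI 𝒜 hJ hm hx e
      · intro j hj
        rw [hcc, if_neg (by omega)]
      · rw [hq, Ideal.Quotient.eq]
        apply mem_of_hcomp_mem 𝒜
        intro j
        rw [map_sub, hcc]
        split_ifs with h
        · rw [sub_self]; exact zero_mem _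
        · rw [zero_sub]
          exact neg_mem (hM j (by omega) _ (hcomp_mem 𝒜 j y) (hcomp_satI 𝒜 hJ hm hx j))
  have hWV : W ≤ V := by
    rintro x ⟨h1, h2⟩
    exact ⟨le_satI m J h1, h2⟩
  have hker : LinearMap.ker (q.domRestrict V) = W.comap V.subtype := by
    ext x
    rw [LinearMap.mem_ker, LinearMap.domRestrict_apply, hq, Ideal.Quotient.eq_zero_iff_mem,
      Submodule.mem_comap]
    exact ⟨fun h => ⟨h, x.2.2⟩, fun h => h.1⟩
  have hr := LinearMap.finrank_range_add_finrank_ker (q.domRestrict V)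
  rw [hker, LinearMap.range_domRestrict, hmap,
    (Submodule.comapSubtypeEquivOfLe hWV).finrank_eq] at hr
  exact hr

theorem statement1 (k : Type) [Field k] [CharZero k]
    (R : Type) [CommRing R] [IsDomain R] [Algebra k R]
    (𝒜 : ℕ → Submodule k R) [GradedAlgebra 𝒜]
    -- `R` is a quotient of a polynomial ring by a homogeneous prime ideal:
    -- a finitely generated graded domain with standard grading
    (hFG : Algebra.FiniteType k R)
    (hstd : Algebra.adjoin k (𝒜 1 : Set R) = ⊤)
    -- the maximal homogeneous (irrelevant) ideal
    (m : Ideal R) (hm : m = (HomogeneousIdeal.irrelevant 𝒜).toIdeal)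
    -- `d = dim R`
    (d : ℕ) (hd : ringKrullDim R = d)
    -- `depth (R_m) ≥ 2`
    (hdepth : ∃ a b : R, a ∈ m ∧ b ∈ m ∧ RingTheory.Sequence.IsRegular R [a, b])
    -- a homogeneous ideal
    (I : Ideal R) (hI : I.IsHomogeneous 𝒜) :
    ∃ L : ℝ,
      Tendsto (fun n : ℕ =>
          (Module.finrank k (H0 (M := R ⧸ I ^ n) m) : ℝ) / (n : ℝ) ^ d)
        atTop (nhds L) := by
  have hmh : m.IsHomogeneous 𝒜 := by
    rw [hm]; exact (HomogeneousIdeal.irrelevant 𝒜).isHomogeneous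
  have hm1 : ∀ x ∈ 𝒜 1, x ∈ m := by
    intro x hx
    rw [hm]
    exact HomogeneousIdeal.mem_irrelevant_of_mem 𝒜 one_pos hx
  have hnoeth : IsNoetherianRing R := Algebra.FiniteType.isNoetherianRing k R
  by_cases hI0 : I = ⊥
  · -- the zero ideal
    refine ⟨0, ?_⟩
    obtain ⟨a, b, ham, -, hreg⟩ := hdepth
    have ha0 : a ≠ 0 := by
      rintro rfl
      have h1 := ((RingTheory.Sequence.isWeaklyRegular_cons_iff R (0 : R) [b]).1
        hreg.toIsWeaklyRegular).1
      have h2 : (1 : R) = 0 := h1 (by simp)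
      exact one_ne_zero h2
    have hev : ∀ᶠ n : ℕ in atTop,
        (0 : ℝ) = (Module.finrank k (H0 (M := R ⧸ I ^ n) m) : ℝ) / (n : ℝ) ^ d := by
      filter_upwards [eventually_ge_atTop 1] with n hn
      have hIn : I ^ n = ⊥ := by
        rw [hI0, ← Ideal.zero_eq_bot, zero_pow (by omega)]
      have hbot : H0 (M := R ⧸ I ^ n) m = ⊥ := by
        rw [eq_bot_iff]
        intro x hx
        obtain ⟨y, rfl⟩ := Ideal.Quotient.mk_surjective x
        rw [mk_mem_H0] at hx
        obtain ⟨N, hN⟩ := hx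
        have h1 := hN (a ^ N) (Ideal.pow_mem_pow ham N)
        rw [hIn, Ideal.mem_bot] at h1
        rcases mul_eq_zero.1 h1 with h2 | h2
        · exact absurd h2 (pow_ne_zero _ ha0)
        · rw [h2, map_zero]; exact zero_mem _
      have h0 : Module.finrank k (H0 (M := R ⧸ I ^ n) m) = 0 := by
        rw [hbot]
        exact Module.finrank_zero_of_subsingleton
      rw [h0]
      simp
    exact tendsto_const_nhds.congr' hev
  obtain ⟨f, hfI, hf0⟩ := Submodule.exists_mem_ne_zero_of_ne_bot hI0
  obtain ⟨s, hsd, ζ, hlim⟩ := family_limit (k := k) (R := R) hFG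
  have hsd' : s ≤ d := by
    rw [hd] at hsd
    exact_mod_cast hsd
  obtain ⟨c0, hc0⟩ := linear_bound 𝒜 hI hmh hm1 hstd
  obtain ⟨T, hT, hTgen⟩ := exists_finset_gen 𝒜 hFG hstd
  choose D hD using hcomp_bound 𝒜
  set e1 := D f
  set e2 := ∑ i, D (ζ i)
  have hζ : ∀ i, ζ i ∈ rlow 𝒜 e2 := fun i => rlow_mono 𝒜
    (Finset.single_le_sum (f := fun i => D (ζ i)) (fun _ _ => Nat.zero_le _) (Finset.mem_univ i))
    (hD (ζ i))
  set c := c0 + e1 + e2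
  have hc : ∀ n, 1 ≤ n → ∀ j, c * n < j → ∀ f ∈ 𝒜 j, f ∈ satI m (I ^ n) → f ∈ I ^ n := by
    intro n hn j hj
    refine hc0 n hn j ?_
    have : c0 * n ≤ c * n := Nat.mul_le_mul_right _ (by omega)
    omega
  set E : Submodule k R := (1 ⊔ Submodule.span k (T : Set R)) ^ c
  have hE : E.FG := by
    refine Submodule.FG.pow (Submodule.FG.sup ?_ (Submodule.fg_span T.finite_toSet)) _
    rw [Submodule.one_eq_span]
    exact Submodule.fg_span (Set.finite_singleton _)
  have hlowE : ∀ n, rlow 𝒜 (c * n) ≤ E ^ n := by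
    intro n
    rw [← pow_mul]
    exact rlow_le_pow 𝒜 T hT hTgen _
  have hfmem : ∀ n, ∀ w : Fin s →₀ ℕ, (∑ i, w i) ≤ n →
      f ^ n * ∏ i, ζ i ^ w i ∈ I ^ n ∧ f ^ n * ∏ i, ζ i ^ w i ∈ rlow 𝒜 (c * n) := by
    intro n w hw
    refine ⟨Ideal.mul_mem_right _ _ (Ideal.pow_mem_pow hfI n), ?_⟩
    refine rlow_mono 𝒜 ?_ (rlow_mul 𝒜 (rlow_pow 𝒜 (hD f) n) (rlow_prod 𝒜 Finset.univ hζ w))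
    have h1 : e2 * ∑ i, w i ≤ e2 * n := Nat.mul_le_mul_left _ hw
    have h2 : c * n = c0 * n + e1 * n + e2 * n := by simp only [c]; ring
    change e1 * n + e2 * ∑ i, w i ≤ c * n
    rw [h2]
    omega
  obtain ⟨l1, hl1, hfd1⟩ := hlim
    (fun n => (satI m (I ^ n)).restrictScalars k ⊓ rlow 𝒜 (c * n)) E hE
    (fun n _ => inf_le_right.trans (hlowE n))
    (by
      rintro a b - - x ⟨hx1, hx2⟩ y ⟨hy1, hy2⟩
      refine ⟨?_, ?_⟩
      · rw [pow_add]
        exact satI_mul_satI hx1 hy1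
      · rw [mul_add]
        exact rlow_mul 𝒜 hx2 hy2)
    f hf0
    (fun n _ w hw => ⟨le_satI _ _ (hfmem n w hw).1, (hfmem n w hw).2⟩)
  obtain ⟨l2, hl2, -⟩ := hlim
    (fun n => (I ^ n).restrictScalars k ⊓ rlow 𝒜 (c * n)) E hE
    (fun n _ => inf_le_right.trans (hlowE n))
    (by
      rintro a b - - x ⟨hx1, hx2⟩ y ⟨hy1, hy2⟩
      refine ⟨?_, ?_⟩
      · rw [pow_add]
        exact Ideal.mul_mem_mul hx1 hy1
      · rw [mul_add]
        exact rlow_mul 𝒜 hx2 hy2)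
    f hf0
    (fun n _ w hw => hfmem n w hw)
  obtain ⟨t, rfl⟩ := Nat.exists_eq_add_of_le hsd'
  have hinv : Tendsto (fun n : ℕ => ((n : ℝ)⁻¹) ^ t) atTop (nhds (0 ^ t)) :=
    tendsto_inv_atTop_nhds_zero_nat.pow t
  refine ⟨(l1 - l2) * 0 ^ t, ((hl1.sub hl2).mul hinv).congr' ?_⟩
  filter_upwards [eventually_ge_atTop 1] with n hn
  have := hfd1 n hn
  have hr := finrank_H0 𝒜 (homog_pow 𝒜 hI n) hmh (c * n) (hc n hn)
  have hr' : (Module.finrank k (H0 (M := R ⧸ I ^ n) m) : ℝ) +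
      (Module.finrank k ((I ^ n).restrictScalars k ⊓ rlow 𝒜 (c * n) : Submodule k R) : ℝ) =
      (Module.finrank k ((satI m (I ^ n)).restrictScalars k ⊓ rlow 𝒜 (c * n) : Submodule k R) : ℝ) :=
    by exact_mod_cast hr
  rw [← hr', pow_add, inv_pow, ← sub_div, add_sub_cancel_right, div_mul_eq_div_div]
  rfl
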